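/- Let n ≥ 2, let q be a prime power with (n,q) ≠ (2,2), (2,3), and let G be a finite almost simple group whose socle G₀ is isomorphic to PSL(n,q). If the quotient group G/G₀ is abelian, then G contains an abelian subgroup A such that G = A·G₀. -/

import Mathlib

namespace AbSup
open Matrix

/-- The group of field automorphisms times a sign (for the inverse transpose). -/
abbrev TT (F : Type*) [Field F] := RingAut F × ℤˣ

section defs
variable {F : Type*} [Field F] {ι : Type*} [Fintype ι] [DecidableEq ι]

/-- Field automorphisms acting on `GL`. -/
def fieldAut : RingAut F →* MulAut (GL ι F) where
  toFun σ :=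
    { toFun := fun g => GeneralLinearGroup.map (σ : F →+* F) g
      invFun := fun g => GeneralLinearGroup.map ((σ⁻¹ : RingAut F) : F →+* F) g
      left_inv := fun g => by
        ext i j
        change σ⁻¹ (σ (g i j)) = g i j
        rw [← RingAut.mul_apply]; simp
      right_inv := fun g => by
        ext i j
        change σ (σ⁻¹ (g i j)) = g i j
        rw [← RingAut.mul_apply]; simp
      map_mul' := fun g h => by simp }
  map_one' := by
    ext g i j
    rfl
  map_mul' σ τ := by
    ext g i j
    rfl

/-- The inverse transpose automorphism. -/
def gam : MulAut (GL ι F) where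
  toFun g := ⟨(g⁻¹).valᵀ, g.valᵀ, by rw [← transpose_mul]; simp, by rw [← transpose_mul]; simp⟩
  invFun g := ⟨(g⁻¹).valᵀ, g.valᵀ, by rw [← transpose_mul]; simp, by rw [← transpose_mul]; simp⟩
  left_inv g := by
    ext i j
    rfl
  right_inv g := by
    ext i j
    rfl
  map_mul' g h := by
    apply Units.ext
    change ((g * h)⁻¹).valᵀ = (g⁻¹).valᵀ * (h⁻¹).valᵀ
    rw [← transpose_mul, _root_.mul_inv_rev]; rfl

lemma gam_val (g : GL ι F) : (gam g).val = (g⁻¹).valᵀ := rfl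

lemma gam_gam : (gam : MulAut (GL ι F)) * gam = 1 := by
  ext g i j
  rfl

lemma gam_field (σ : RingAut F) : (gam : MulAut (GL ι F)) * fieldAut σ = fieldAut σ * gam := by
  ext g i j
  rfl

/-- Combined action of `TT F` on `GL`. -/
def theta : TT F →* MulAut (GL ι F) where
  toFun τ := fieldAut τ.1 * (if τ.2 = 1 then 1 else gam)
  map_one' := by simp
  map_mul' := by
    rintro ⟨σ, ε⟩ ⟨σ', ε'⟩
    have h1 : (-1 : ℤˣ) ≠ 1 := by decide
    rcases Int.units_eq_one_or ε with rfl | rfl <;> rcases Int.units_eq_one_or ε' with rfl | rfl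
    · simp
    · simp [mul_assoc]
    · simp [mul_assoc, gam_field]
    · simp only [Prod.mk_mul_mk, map_mul, h1, if_false]
      rw [mul_assoc, mul_assoc, ← mul_assoc gam, gam_field, mul_assoc, gam_gam]
      simp

lemma theta_one (σ : RingAut F) (g : GL ι F) : theta (σ, 1) g = fieldAut σ g := by
  simp [theta]

lemma theta_neg (σ : RingAut F) (g : GL ι F) : theta (σ, -1) g = fieldAut σ (gam g) := by
  have h1 : (-1 : ℤˣ) ≠ 1 := by decide
  simp [theta, h1]

lemma fieldAut_apply (σ : RingAut F) (g : GL ι F) (i j : ι) :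
    (fieldAut σ g) i j = σ (g i j) := rfl

/-- The action of `TT F` on units. -/
def chi (τ : TT F) : Fˣ →* Fˣ :=
  (zpowGroupHom (τ.2 : ℤ)).comp (Units.map ((τ.1 : F →+* F) : F →* F))

lemma chi_one (σ : RingAut F) (u : Fˣ) :
    chi (σ, 1) u = Units.map ((σ : F →+* F) : F →* F) u := by
  simp [chi]

lemma chi_neg (σ : RingAut F) (u : Fˣ) :
    chi (σ, -1) u = (Units.map ((σ : F →+* F) : F →* F) u)⁻¹ := by
  simp [chi]

lemma det_fieldAut (σ : RingAut F) (g : GL ι F) :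
    GeneralLinearGroup.det (fieldAut σ g) =
      Units.map ((σ : F →+* F) : F →* F) (GeneralLinearGroup.det g) :=
  GeneralLinearGroup.map_det _ _

lemma det_gam (g : GL ι F) :
    GeneralLinearGroup.det (gam g) = (GeneralLinearGroup.det g)⁻¹ := by
  rw [← map_inv]
  apply Units.ext
  change ((g⁻¹).valᵀ).det = (g⁻¹).val.det
  rw [det_transpose]

lemma det_theta (τ : TT F) (g : GL ι F) :
    GeneralLinearGroup.det (theta τ g) = chi τ (GeneralLinearGroup.det g) := by
  obtain ⟨σ, ε⟩ := τ
  rcases Int.units_eq_one_or ε with rfl | rfl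
  · rw [theta_one, chi_one, det_fieldAut]
  · rw [theta_neg, chi_neg, det_fieldAut, det_gam, map_inv]

variable (F ι) in
/-- Automorphisms of `GL` preserving `SL`. -/
def DD : Subgroup (MulAut (GL ι F)) where
  carrier := {θ | ∀ g, GeneralLinearGroup.det (θ g) = 1 ↔ GeneralLinearGroup.det g = 1}
  one_mem' := fun g => Iff.rfl
  mul_mem' := fun {a b} ha hb g => (ha (b g)).trans (hb g)
  inv_mem' := fun {a} ha g => by
    rw [← ha]
    simp

/-- Element of `SL` from an element of `GL` of determinant one. -/
def toSL (g : GL ι F) (h : GeneralLinearGroup.det g = 1) : Matrix.SpecialLinearGroup ι F :=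
  ⟨g.val, by have := congrArg Units.val h; simpa using this⟩

lemma det_coe_SL (A : Matrix.SpecialLinearGroup ι F) :
    GeneralLinearGroup.det (Matrix.SpecialLinearGroup.toGL A) = 1 := by
  apply Units.ext
  exact A.2

lemma toGL_toSL (g : GL ι F) (h : GeneralLinearGroup.det g = 1) :
    Matrix.SpecialLinearGroup.toGL (toSL g h) = g := by
  apply Units.ext; rfl

/-- restriction to `SL` -/
def resSL : DD F ι →* MulAut (Matrix.SpecialLinearGroup ι F) where
  toFun θ :=
    { toFun := fun A => toSL (θ.1 (Matrix.SpecialLinearGroup.toGL A)) ((θ.2 _).2 (det_coe_SL A))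
      invFun := fun A => toSL ((θ⁻¹).1 (Matrix.SpecialLinearGroup.toGL A)) (((θ⁻¹).2 _).2 (det_coe_SL A))
      left_inv := fun A => by
        apply Matrix.SpecialLinearGroup.toGL_injective
        simp [toGL_toSL]
      right_inv := fun A => by
        apply Matrix.SpecialLinearGroup.toGL_injective
        simp [toGL_toSL]
      map_mul' := fun A B => by
        apply Matrix.SpecialLinearGroup.toGL_injective
        simp [toGL_toSL] }
  map_one' := by
    apply MulEquiv.ext
    intro A
    apply Matrix.SpecialLinearGroup.toGL_injective
    simp [toGL_toSL]
  map_mul' θ θ' := by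
    apply MulEquiv.ext
    intro A
    apply Matrix.SpecialLinearGroup.toGL_injective
    simp [toGL_toSL]

lemma toGL_resSL (θ : DD F ι) (A : Matrix.SpecialLinearGroup ι F) :
    Matrix.SpecialLinearGroup.toGL (resSL θ A) = θ.1 (Matrix.SpecialLinearGroup.toGL A) :=
  toGL_toSL _ ((θ.2 _).2 (det_coe_SL A))

/-- automorphisms act on the central quotient -/
def quotAut {H : Type*} [Group H] : MulAut H →* MulAut (H ⧸ Subgroup.center H) where
  toFun α := QuotientGroup.congr _ _ α (Subgroup.characteristic_iff_map_eq.1 inferInstance α)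
  map_one' := by
    apply MulEquiv.ext
    intro x
    induction x using QuotientGroup.induction_on
    rfl
  map_mul' a b := by
    apply MulEquiv.ext
    intro x
    induction x using QuotientGroup.induction_on
    rfl

variable (F ι) in
/-- `PSL` -/
abbrev PS := Matrix.SpecialLinearGroup ι F ⧸ Subgroup.center (Matrix.SpecialLinearGroup ι F)

/-- the projection -/
abbrev pr : Matrix.SpecialLinearGroup ι F →* PS F ι := QuotientGroup.mk' _

def LL : DD F ι →* MulAut (PS F ι) := quotAut.comp resSL

lemma LL_pr (θ : DD F ι) (A : Matrix.SpecialLinearGroup ι F) : LL θ (pr A) = pr (resSL θ A) := rfl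

/-- conjugation -/
def cD : GL ι F →* DD F ι :=
  (MulAut.conj : GL ι F →* MulAut (GL ι F)).codRestrict _ (fun g h => by
    simp)

lemma cD_val (g : GL ι F) : (cD g).1 = MulAut.conj g := rfl

/-- field and graph automorphisms -/
def tD : TT F →* DD F ι :=
  theta.codRestrict _ (fun τ h => by
    rw [det_theta]
    refine map_eq_one_iff _ ?_
    obtain ⟨σ, ε⟩ := τ
    rcases Int.units_eq_one_or ε with rfl | rfl
    · intro u v h
      rw [chi_one, chi_one] at h
      have := congrArg Units.val h
      exact Units.ext (by simpa using this)
    · intro u v h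
      rw [chi_neg, chi_neg] at h
      have := congrArg Units.val (inv_injective h)
      exact Units.ext (by simpa using this))

lemma tD_val (τ : TT F) : (tD τ : DD F ι).1 = theta τ := rfl

lemma tD_cD (τ : TT F) (g : GL ι F) : tD τ * cD g = cD (theta τ g) * tD τ := by
  apply Subtype.ext
  apply MulEquiv.ext
  intro h
  simp [cD_val, tD_val]

/-- conjugation on `PSL` -/
def cL : GL ι F →* MulAut (PS F ι) := LL.comp cD

/-- field and graph automorphisms on `PSL` -/
def tL : TT F →* MulAut (PS F ι) := LL.comp tD

lemma tL_cL (τ : TT F) (g : GL ι F) : (tL τ : MulAut (PS F ι)) * cL g = cL (theta τ g) * tL τ := by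
  simp only [tL, cL, MonoidHom.comp_apply, ← map_mul, tD_cD]

lemma cL_pr (g : GL ι F) (A : Matrix.SpecialLinearGroup ι F) :
    cL g (pr A) = pr (resSL (cD g) A) := rfl

lemma resSL_cD_val (g : GL ι F) (A : Matrix.SpecialLinearGroup ι F) :
    (resSL (cD g) A).val = g.val * A.val * (g⁻¹).val := rfl

lemma cL_coe (A : Matrix.SpecialLinearGroup ι F) :
    cL (Matrix.SpecialLinearGroup.toGL A) = MulAut.conj (pr A) := by
  apply MulEquiv.ext
  intro x
  obtain ⟨B, rfl⟩ := QuotientGroup.mk'_surjective _ x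
  rw [cL_pr, MulAut.conj_apply, ← map_inv, ← map_mul, ← map_mul]
  congr 1

lemma cL_scalar (u : Fˣ) : cL (GeneralLinearGroup.scalar ι u) = 1 := by
  apply MulEquiv.ext
  intro x
  obtain ⟨B, rfl⟩ := QuotientGroup.mk'_surjective _ x
  rw [cL_pr, MulAut.one_apply]
  congr 1
  apply Matrix.SpecialLinearGroup.toGL_injective
  rw [toGL_resSL, cD_val, MulAut.conj_apply, GeneralLinearGroup.scalar_commute]
  simp

lemma pr_eq_iff (A B : Matrix.SpecialLinearGroup ι F) :
    pr A = pr B ↔ ∃ z : F, z ^ (Fintype.card ι) = 1 ∧ A.val = z • B.val := by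
  rw [QuotientGroup.mk'_apply, QuotientGroup.mk'_apply, eq_comm, QuotientGroup.eq,
    Matrix.SpecialLinearGroup.mem_center_iff]
  constructor
  · rintro ⟨r, hr, h⟩
    refine ⟨r, hr, ?_⟩
    have : A = B * (B⁻¹ * A) := by group
    rw [this, Matrix.SpecialLinearGroup.coe_mul, ← h]
    ext i j
    simp [mul_comm]
  · rintro ⟨z, hz, h⟩
    refine ⟨z, hz, ?_⟩
    rw [Matrix.SpecialLinearGroup.coe_mul, h, Matrix.mul_smul, ← Matrix.SpecialLinearGroup.coe_mul]
    ext i j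
    simp [Matrix.one_apply, Matrix.diagonal_apply]

end defs
end AbSup


namespace AbSup
open Matrix

section basics
variable {F : Type*} [Field F] {ι : Type*} [Fintype ι] [DecidableEq ι]

lemma unip_scalar [Nonempty ι] {A B : Matrix ι ι F} {z : F} (hA : (A - 1) * (A - 1) = 0)
    (hB : (B - 1) * (B - 1) = 0) (h : A = z • B) : z = 1 := by
  by_contra hz
  set N := B - 1 with hN
  have hBN : B = 1 + N := by rw [hN]; abel
  have e1 : A - 1 = (z - 1) • (1 : Matrix ι ι F) + z • N := by
    rw [h, hBN]; module
  have e2 : (A - 1) * (A - 1) = ((z - 1) ^ 2) • (1 : Matrix ι ι F) + (2 * z * (z - 1)) • N := by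
    rw [e1]
    simp only [add_mul, mul_add, Matrix.smul_mul, Matrix.mul_smul, hB, one_mul, mul_one]
    module
  rw [hA] at e2
  have e3 : N = 0 := by
    have : (0 : Matrix ι ι F) * N = ((z - 1) ^ 2) • N := by
      rw [e2, add_mul, Matrix.smul_mul, Matrix.smul_mul, hB]; simp
    rw [zero_mul] at this
    exact (smul_eq_zero.1 this.symm).resolve_left (pow_ne_zero _ (sub_ne_zero.2 hz))
  rw [e3, smul_zero, add_zero] at e2
  exact (smul_ne_zero (pow_ne_zero 2 (sub_ne_zero.2 hz)) one_ne_zero) e2.symm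

/-- the transvection in `SL` -/
abbrev tv {i j : ι} (h : i ≠ j) (a : F) : Matrix.SpecialLinearGroup ι F :=
  Matrix.SpecialLinearGroup.transvection h a

lemma tv_val {i j : ι} (h : i ≠ j) (a : F) : (tv h a).val = 1 + Matrix.single i j a := rfl

lemma fix_scalar {g : GL ι F}
    (hg : ∀ (i j : ι) (hij : i ≠ j), cL g (pr (tv hij 1)) = pr (tv hij 1)) : ∃ u : Fˣ, g = GeneralLinearGroup.scalar ι u := by
  rcases isEmpty_or_nonempty ι with hι | hι
  · exact ⟨1, Units.ext (by ext i; exact hι.elim i)⟩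
  have key : ∀ i j : ι, i ≠ j → Commute (Matrix.single i j (1 : F)) g.val := by
    intro i j hij
    have h1 := hg i j hij
    rw [cL_pr, pr_eq_iff] at h1
    obtain ⟨z, -, hz⟩ := h1
    rw [resSL_cD_val, tv_val] at hz
    have e1 : g.val * (1 + Matrix.single i j 1) * (g⁻¹).val - 1 =
        g.val * Matrix.single i j 1 * (g⁻¹).val := by
      rw [mul_add, add_mul, mul_one, Units.mul_inv]; abel
    have e2 : Matrix.single i j (1 : F) * Matrix.single i j 1 = 0 := by
      rw [Matrix.single_mul_single_of_ne]; exact hij.symm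
    have hz1 : z = 1 := by
      refine unip_scalar ?_ ?_ hz
      · rw [e1]
        have : g.val * Matrix.single i j 1 * (g⁻¹).val * (g.val * Matrix.single i j 1 * (g⁻¹).val)
          = g.val * (Matrix.single i j 1 * ((g⁻¹).val * g.val) * Matrix.single i j 1) *
            (g⁻¹).val := by
          simp only [mul_assoc]
        rw [this, Units.inv_mul, mul_one, e2]; simp
      · rw [add_sub_cancel_left, e2]
    rw [hz1, one_smul] at hz
    have h3 : g.val * Matrix.single i j 1 * (g⁻¹).val = Matrix.single i j 1 := by
      rw [← e1, hz]; simp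
    have h4 : g.val * Matrix.single i j 1 * (g⁻¹).val * g.val = Matrix.single i j 1 * g.val := by
      rw [h3]
    rw [mul_assoc, Units.inv_mul, mul_one] at h4
    exact h4.symm
  obtain ⟨r, hr⟩ := Matrix.mem_range_scalar_of_commute_single (fun i j hij => key i j hij)
  have hr0 : r ≠ 0 := by
    rintro rfl
    rw [map_zero] at hr
    exact g.ne_zero hr.symm
  refine ⟨Units.mk0 r hr0, Units.ext ?_⟩
  rw [GeneralLinearGroup.coe_scalar, ← hr]
  rfl

lemma cL_eq_one {g : GL ι F} (hg : cL g = 1) :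
    ∃ u : Fˣ, g = GeneralLinearGroup.scalar ι u :=
  fix_scalar (fun i j hij => by rw [hg]; rfl)

lemma det_of_inn {g : GL ι F} {s : PS F ι} (hg : cL g = MulAut.conj s) :
    ∃ u : Fˣ, GeneralLinearGroup.det g = u ^ Fintype.card ι := by
  obtain ⟨A, rfl⟩ := QuotientGroup.mk'_surjective _ s
  rw [← cL_coe] at hg
  have : cL (g * (Matrix.SpecialLinearGroup.toGL A)⁻¹) = 1 := by
    rw [map_mul, map_inv, hg, mul_inv_cancel]
  obtain ⟨u, hu⟩ := cL_eq_one this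
  refine ⟨u, ?_⟩
  rw [mul_inv_eq_iff_eq_mul] at hu
  rw [hu, map_mul, det_coe_SL, mul_one, GeneralLinearGroup.det_scalar]

variable (F ι) in
/-- inner automorphisms -/
abbrev Inn : Subgroup (MulAut (PS F ι)) := (MulAut.conj : PS F ι →* MulAut (PS F ι)).range

lemma inn_of_det {g : GL ι F} {u : Fˣ} (hg : GeneralLinearGroup.det g = u ^ Fintype.card ι) :
    cL g ∈ Inn F ι := by
  have h1 : GeneralLinearGroup.det (g * (GeneralLinearGroup.scalar ι u)⁻¹) = 1 := by
    rw [map_mul, map_inv, GeneralLinearGroup.det_scalar, hg, mul_inv_cancel]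
  have h2 : cL g = cL (Matrix.SpecialLinearGroup.toGL
      (toSL (g * (GeneralLinearGroup.scalar ι u)⁻¹) h1)) := by
    rw [toGL_toSL, map_mul, map_inv, cL_scalar]; simp
  rw [h2, cL_coe]
  exact ⟨_, rfl⟩

end basics

section construct
variable {F : Type*} [Field F]

variable {m : Type*} [Fintype m] [DecidableEq m]

/-- diagonal matrices -/
def dg : (m → Fˣ) →* GL m F where
  toFun u := ⟨diagonal (fun i => (u i : F)), diagonal (fun i => ((u i)⁻¹ : Fˣ)), by simp, by simp⟩
  map_one' := by apply Units.ext; simp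
  map_mul' u v := by apply Units.ext; simp

/-- permutation matrices -/
def pm (σ : Equiv.Perm m) : GL m F :=
  ⟨σ.permMatrix F, σ⁻¹.permMatrix F, by rw [← Matrix.permMatrix_mul]; simp,
    by rw [← Matrix.permMatrix_mul]; simp⟩

lemma theta_dg (τ : TT F) (u : m → Fˣ) : theta τ (dg u) = dg (fun i => chi τ (u i)) := by
  obtain ⟨σ, ε⟩ := τ
  rcases Int.units_eq_one_or ε with rfl | rfl
  · rw [theta_one]
    ext i j
    rw [fieldAut_apply]
    simp only [chi_one]
    change σ (diagonal (fun i => (u i : F)) i j) = diagonal (fun i => σ (u i)) i j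
    by_cases h : i = j
    · subst h; simp
    · simp [h]
  · rw [theta_neg]
    ext i j
    rw [fieldAut_apply]
    simp only [chi_neg]
    change σ ((diagonal (fun i => (((u i)⁻¹ : Fˣ) : F)))ᵀ i j) =
      diagonal (fun i => (((Units.map ((σ : F →+* F) : F →* F) (u i))⁻¹ : Fˣ) : F)) i j
    by_cases h : i = j
    · subst h; simp
    · simp [h, diagonal_apply_ne _ (Ne.symm h)]

lemma theta_pm (τ : TT F) (π : Equiv.Perm m) : theta τ (pm π : GL m F) = pm π := by
  obtain ⟨σ, ε⟩ := τ
  rcases Int.units_eq_one_or ε with rfl | rfl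
  · rw [theta_one]
    ext i j
    rw [fieldAut_apply]
    change σ (π.permMatrix F i j) = π.permMatrix F i j
    simp only [Equiv.Perm.permMatrix, Equiv.toPEquiv, PEquiv.toMatrix_apply]
    split_ifs <;> simp
  · rw [theta_neg]
    ext i j
    rw [fieldAut_apply]
    change σ ((π⁻¹.permMatrix F)ᵀ i j) = π.permMatrix F i j
    simp only [Equiv.Perm.permMatrix, PEquiv.toMatrix_apply, transpose_apply,
      Equiv.toPEquiv_apply, Option.mem_def, Option.some.injEq]
    have : (π⁻¹ j = i) ↔ (π i = j) := by
      rw [Equiv.Perm.inv_eq_iff_eq, eq_comm]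
    simp only [this]
    split_ifs <;> simp

lemma det_dg (u : m → Fˣ) : GeneralLinearGroup.det (dg u) = ∏ i, u i := by
  apply Units.ext
  change (diagonal (fun i => (u i : F))).det = _
  simp

lemma det_pm (π : Equiv.Perm m) :
    (GeneralLinearGroup.det (pm π : GL m F) : F) = (Equiv.Perm.sign π : ℤ) := by
  change (π.permMatrix F).det = _
  rw [det_permutation]

lemma pm_dg (π : Equiv.Perm m) (u : m → Fˣ) : pm π * dg u = dg (fun i => u (π i)) * pm π := by
  ext i j
  change (π.permMatrix F * diagonal (fun i => (u i : F))) i j =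
    (diagonal (fun i => (u (π i) : F)) * π.permMatrix F) i j
  rw [mul_diagonal, diagonal_mul]
  simp only [Equiv.Perm.permMatrix, PEquiv.toMatrix_apply,
      Equiv.toPEquiv_apply, Option.mem_def, Option.some.injEq]
  by_cases h : π i = j
  · simp [h]
  · simp [h]

lemma dg_const (c : Fˣ) : dg (fun _ : m => c) = GeneralLinearGroup.scalar m c := by
  ext i j
  rfl

/-- twisted cycle -/
def PP (e : ℕ) (ν : Fˣ) : GL (Fin (e + 1)) F :=
  dg (fun i => if i = Fin.last e then ν else 1) * pm (finRotate (e + 1))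

/-- powers diagonal -/
def aa (e : ℕ) (c : Fˣ) : GL (Fin (e + 1)) F := dg (fun i => (c⁻¹) ^ (i : ℕ))

lemma theta_PP (τ : TT F) (e : ℕ) (ν : Fˣ) : theta τ (PP e ν) = PP e (chi τ ν) := by
  rw [PP, map_mul, theta_dg, theta_pm, PP]
  congr 2
  funext i
  split_ifs <;> simp

lemma theta_aa (τ : TT F) (e : ℕ) (c : Fˣ) : theta τ (aa e c) = aa e (chi τ c) := by
  rw [aa, theta_dg, aa]
  simp

lemma aa_mul (e : ℕ) (c d : Fˣ) : aa e c * aa e d = aa e (c * d) := by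
  rw [aa, aa, aa, ← map_mul]
  congr 1
  funext i
  simp [mul_pow, mul_comm]

lemma det_aa (e : ℕ) : ∃ s : ℤ, ∀ c : Fˣ, GeneralLinearGroup.det (aa e c) = c ^ s := by
  refine ⟨- ∑ i : Fin (e + 1), ((i : ℕ) : ℤ), fun c => ?_⟩
  rw [aa, det_dg, Finset.prod_pow_eq_pow_sum, _root_.zpow_neg]
  rw [inv_pow, ← _root_.zpow_natCast]
  push_cast
  rfl

lemma aa_PP (e : ℕ) (c ν : Fˣ) :
    aa e c * PP e (c ^ (e + 1) * ν) = GeneralLinearGroup.scalar _ c * PP e ν * aa e c := by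
  rw [PP, PP, aa, mul_assoc, mul_assoc, pm_dg, ← dg_const, ← mul_assoc, ← mul_assoc, ← mul_assoc,
    ← map_mul, ← map_mul, ← map_mul]
  congr 2
  funext i
  simp only [Pi.mul_apply]
  refine Fin.lastCases ?_ (fun j => ?_) i
  · rw [if_pos rfl, if_pos rfl, finRotate_last]
    simp only [Fin.val_last, Fin.val_zero, pow_zero, mul_one]
    rw [pow_succ, inv_pow, mul_assoc, inv_mul_cancel_left]
  · rw [if_neg (Fin.castSucc_lt_last j).ne, if_neg (Fin.castSucc_lt_last j).ne]
    have : finRotate (e + 1) j.castSucc = j.succ := by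
      rw [finRotate_apply, Fin.coeSucc_eq_succ]
    rw [this]
    simp only [Fin.val_castSucc, Fin.val_succ, mul_one]
    rw [pow_succ, mul_comm, mul_assoc]; simp

lemma det_PP (e : ℕ) (ν : Fˣ) : GeneralLinearGroup.det (PP e ν) = (-1) ^ e * ν := by
  rw [PP, map_mul, det_dg]
  apply Units.ext
  rw [Units.val_mul, det_pm, sign_finRotate]
  simp [mul_comm]

variable {ι : Type*} [Fintype ι] [DecidableEq ι] {o : Type*} [Fintype o] [DecidableEq o]

/-- block diagonal embedding -/
def bd (eq : m × o ≃ ι) : (o → GL m F) →* GL ι F :=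
  (Units.map (((reindexAlgEquiv F F eq : _ →+* Matrix ι ι F).comp
    (blockDiagonalRingHom m o F)) : _ →* _)).comp
    (MulEquiv.piUnits (M := fun _ : o => Matrix m m F)).symm.toMonoidHom

lemma bd_val (eq : m × o ≃ ι) (f : o → GL m F) :
    (bd eq f).val = reindex eq eq (blockDiagonal (fun k => (f k).val)) := rfl

lemma det_bd (eq : m × o ≃ ι) (f : o → GL m F) :
    GeneralLinearGroup.det (bd eq f) = ∏ k, GeneralLinearGroup.det (f k) := by
  apply Units.ext
  change (bd eq f).val.det = _
  rw [bd_val, det_reindex_self, det_blockDiagonal]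
  simp

lemma theta_bd (τ : TT F) (eq : m × o ≃ ι) (f : o → GL m F) :
    theta τ (bd eq f) = bd eq (fun k => theta τ (f k)) := by
  obtain ⟨σ, ε⟩ := τ
  rcases Int.units_eq_one_or ε with rfl | rfl
  · simp only [theta_one]
    ext i j
    rw [fieldAut_apply, bd_val, bd_val]
    simp only [reindex_apply, submatrix_apply, blockDiagonal_apply, fieldAut_apply]
    split_ifs <;> simp
  · simp only [theta_neg]
    ext i j
    rw [fieldAut_apply, gam_val, ← map_inv, bd_val, bd_val]
    simp only [reindex_apply, submatrix_apply, blockDiagonal_apply, fieldAut_apply, gam_val,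
      transpose_apply, Pi.inv_apply]
    by_cases h : (eq.symm i).2 = (eq.symm j).2
    · rw [if_pos h, if_pos h.symm, h]
    · rw [if_neg h, if_neg (Ne.symm h), map_zero]

lemma bd_scalar (eq : m × o ≃ ι) (c : Fˣ) :
    bd eq (fun _ => GeneralLinearGroup.scalar m c) = GeneralLinearGroup.scalar ι c := by
  ext i j
  rw [bd_val]
  simp only [reindex_apply, submatrix_apply, blockDiagonal_apply, GeneralLinearGroup.coe_scalar,
    Matrix.scalar_apply, diagonal_apply]
  by_cases h : i = j
  · subst h; simp
  · rw [if_neg h]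
    by_cases h2 : (eq.symm i).2 = (eq.symm j).2
    · rw [if_pos h2, if_neg]
      intro h3
      exact h (eq.symm.injective (Prod.ext h3 h2))
    · rw [if_neg h2]

end construct
end AbSup


namespace AbSup
open Matrix

section construct
variable {F : Type*} [Field F]
variable {ι : Type*} [Fintype ι] [DecidableEq ι]

lemma theta_scalar {m : Type*} [Fintype m] [DecidableEq m] (τ : TT F) (c : Fˣ) :
    theta τ (GeneralLinearGroup.scalar m c) = GeneralLinearGroup.scalar m (chi τ c) := by
  rw [← dg_const, theta_dg, dg_const]

lemma chi_neg_one (τ : TT F) : chi τ (-1) = -1 := by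
  obtain ⟨σ, ε⟩ := τ
  apply Units.ext
  rcases Int.units_eq_one_or ε with rfl | rfl
  · rw [chi_one]; simp
  · rw [chi_neg]; simp

variable {m : Type*} [Fintype m] [DecidableEq m] {o : Type*} [Fintype o] [DecidableEq o]

/-- constant block diagonal -/
def kap (eq : m × o ≃ ι) : GL m F →* MulAut (PS F ι) :=
  (cL.comp (bd eq)).comp (Pi.constMonoidHom o (GL m F))

/-- single block -/
def bet (eq : m × o ≃ ι) (k : o) : GL m F →* MulAut (PS F ι) :=
  (cL.comp (bd eq)).comp (MonoidHom.mulSingle (fun _ : o => GL m F) k)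

lemma kap_scalar (eq : m × o ≃ ι) (c : Fˣ) : kap eq (GeneralLinearGroup.scalar m c) = 1 := by
  change cL (bd eq (fun _ => GeneralLinearGroup.scalar m c)) = 1
  rw [bd_scalar, cL_scalar]

lemma t_kap (eq : m × o ≃ ι) (τ : TT F) (x : GL m F) :
    tL τ * kap eq x = kap eq (theta τ x) * tL τ := by
  change tL τ * cL (bd eq (fun _ => x)) = cL (bd eq (fun _ => theta τ x)) * tL τ
  rw [tL_cL, theta_bd]

lemma t_bet (eq : m × o ≃ ι) (k : o) (τ : TT F) (x : GL m F) :
    tL τ * bet eq k x = bet eq k (theta τ x) * tL τ := by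
  change tL τ * cL (bd eq (Pi.mulSingle k x)) = cL (bd eq (Pi.mulSingle k (theta τ x))) * tL τ
  rw [tL_cL, theta_bd]
  congr 3
  funext j
  by_cases h : j = k
  · subst h; simp
  · simp [h]

lemma kap_bet (eq : m × o ≃ ι) (k : o) (x y : GL m F) :
    kap eq x * bet eq k y = bet eq k (x * y * x⁻¹) * kap eq x := by
  change cL (bd eq (fun _ => x)) * cL (bd eq (Pi.mulSingle k y)) =
    cL (bd eq (Pi.mulSingle k (x * y * x⁻¹))) * cL (bd eq (fun _ => x))
  rw [← map_mul, ← map_mul, ← map_mul, ← map_mul]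
  congr 2
  funext j
  by_cases h : j = k
  · subst h; simp
  · simp [h]

lemma comm_closure {M : Type*} [Group M] {s : Set M} (h : ∀ x ∈ s, ∀ y ∈ s, x * y = y * x) :
    ∀ x ∈ Subgroup.closure s, ∀ y ∈ Subgroup.closure s, x * y = y * x := by
  have h1 : Subgroup.closure s ≤ Subgroup.centralizer s := by
    rw [Subgroup.closure_le]
    intro x hx
    rw [SetLike.mem_coe, Subgroup.mem_centralizer_iff]
    intro y hy
    exact h y hy x hx
  have h2 : Subgroup.closure s ≤ Subgroup.centralizer (Subgroup.closure s : Set M) := by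
    rw [Subgroup.closure_le]
    intro x hx
    rw [SetLike.mem_coe, Subgroup.mem_centralizer_iff]
    intro y hy
    exact ((Subgroup.mem_centralizer_iff.1 (h1 hy)) x hx).symm
  intro x hx y hy
  exact (Subgroup.mem_centralizer_iff.1 (h2 hy)) x hx

lemma construct (e N : ℕ) (eq : Fin (e + 1) × Fin (N + 1) ≃ ι) (ω l : Fˣ) (τ₁ τ₂ : TT F)
    (hτ : τ₁ * τ₂ = τ₂ * τ₁) (m₁ m₂ k₁ k₂ t₁ t₂ : ℤ) (h1 : chi τ₁ ω = ω ^ m₁)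
    (h2 : chi τ₂ ω = ω ^ m₂) (hk1 : m₁ - 1 = (e + 1) * k₁) (hk2 : m₂ - 1 = (e + 1) * k₂)
    (hl1 : chi τ₁ l = l) (hl2 : chi τ₂ l = l) (ht : k₁ * t₂ = k₂ * t₁) :
    ∃ s : ℤ, ∃ A : Subgroup (MulAut (PS F ι)), (∀ x ∈ A, ∀ y ∈ A, x * y = y * x) ∧
      (∃ g : GL ι F, cL g ∈ A ∧ GeneralLinearGroup.det g = ω ^ (N + 1)) ∧
      (∃ g : GL ι F, cL g ∈ A ∧ GeneralLinearGroup.det g = l ^ (e + 1)) ∧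
      (∃ g : GL ι F, cL g * tL τ₁ ∈ A ∧
        GeneralLinearGroup.det g = ω ^ (t₁ + s * k₁ * (N + 1))) ∧
      (∃ g : GL ι F, cL g * tL τ₂ ∈ A ∧
        GeneralLinearGroup.det g = ω ^ (t₂ + s * k₂ * (N + 1))) := by
  obtain ⟨s, hs⟩ := det_aa (F := F) e
  set ν : Fˣ := (-1) ^ e * ω with hν
  set P : GL (Fin (e + 1)) F := PP e ν with hP
  have hdetP : GeneralLinearGroup.det P = ω := by
    rw [hP, det_PP, hν, ← mul_assoc, ← mul_pow]; simp
  -- the twisting relation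
  have tw : ∀ (τ : TT F) (m k : ℤ), chi τ ω = ω ^ m → m - 1 = (e + 1) * k →
      aa e (ω ^ k) * theta τ P = GeneralLinearGroup.scalar _ (ω ^ k) * P * aa e (ω ^ k) := by
    intro τ m k hm hk
    rw [hP, theta_PP, ← aa_PP]
    congr 2
    rw [hν, map_mul, map_pow, chi_neg_one, hm]
    have : m = (k * ((e + 1 : ℕ) : ℤ)) + 1 := by push_cast; linarith
    rw [this, _root_.zpow_add, _root_.zpow_mul, _root_.zpow_natCast, zpow_one]
    rw [mul_left_comm]
  set α : TT F → ℤ → MulAut (PS F ι) := fun τ k => kap eq (aa e (ω ^ k)) * tL τ with hα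
  have r1 : ∀ (τ : TT F) (m k : ℤ), chi τ ω = ω ^ m → m - 1 = (e + 1) * k →
      α τ k * kap eq P = kap eq P * α τ k := by
    intro τ m k hm hk
    simp only [hα]
    rw [mul_assoc, t_kap, ← mul_assoc, ← map_mul, tw τ m k hm hk, map_mul, map_mul, kap_scalar,
      one_mul, mul_assoc]
  have r2 : ∀ (τ : TT F) (m k : ℤ), chi τ ω = ω ^ m → m - 1 = (e + 1) * k → ∀ t : ℤ,
      α τ k * bet eq 0 (P ^ t) =
        bet eq 0 (GeneralLinearGroup.scalar _ ((ω ^ k) ^ t) * P ^ t) * α τ k := by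
    intro τ m k hm hk t
    simp only [hα]
    rw [mul_assoc, t_bet, ← mul_assoc, kap_bet, mul_assoc]
    congr 2
    rw [map_zpow, ← MulAut.conj_apply, map_zpow, MulAut.conj_apply, tw τ m k hm hk,
      mul_inv_cancel_right]
    have hc : Commute (GeneralLinearGroup.scalar (Fin (e + 1)) (ω ^ k)) P :=
      GeneralLinearGroup.scalar_commute _ _
    rw [hc.mul_zpow t, ← map_zpow]
  have r3 : ∀ (τ : TT F) (k : ℤ), chi τ l = l →
      α τ k * bet eq 0 (GeneralLinearGroup.scalar _ l) =
        bet eq 0 (GeneralLinearGroup.scalar _ l) * α τ k := by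
    intro τ k hl
    simp only [hα]
    rw [mul_assoc, t_bet, theta_scalar, hl, ← mul_assoc, kap_bet, ← mul_assoc,
      ← GeneralLinearGroup.scalar_commute, mul_inv_cancel_right]
  have r4 : α τ₁ k₁ * α τ₂ k₂ = α τ₂ k₂ * α τ₁ k₁ := by
    have aux : ∀ (τ τ' : TT F) (k k' m : ℤ), chi τ ω = ω ^ m →
        α τ k * α τ' k' = kap eq (aa e (ω ^ (k + m * k'))) * tL (τ * τ') := by
      intro τ τ' k k' m hm
      simp only [hα]
      rw [mul_assoc, ← mul_assoc (tL τ), t_kap, theta_aa, map_zpow, hm, mul_assoc, ← map_mul,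
        ← mul_assoc, ← map_mul, aa_mul, ← _root_.zpow_mul, ← _root_.zpow_add]
    rw [aux τ₁ τ₂ k₁ k₂ m₁ h1, aux τ₂ τ₁ k₂ k₁ m₂ h2, hτ]
    have : k₁ + m₁ * k₂ = k₂ + m₂ * k₁ := by
      have e1 : m₁ = (e + 1) * k₁ + 1 := by linarith
      have e2 : m₂ = (e + 1) * k₂ + 1 := by linarith
      rw [e1, e2]; ring
    rw [this]
  have hPP : kap eq P * bet eq 0 P = bet eq 0 P * kap eq P := by
    rw [kap_bet, mul_inv_cancel_right]
  have hPl : ∀ c : Fˣ, kap eq P * bet eq 0 (GeneralLinearGroup.scalar _ c) =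
      bet eq 0 (GeneralLinearGroup.scalar _ c) * kap eq P := by
    intro c
    rw [kap_bet, ← GeneralLinearGroup.scalar_commute, mul_inv_cancel_right]
  clear_value α
  set X : TT F → ℤ → ℤ → MulAut (PS F ι) := fun τ k t => bet eq 0 (P ^ t) * α τ k with hX
  have hbP : ∀ t : ℤ, kap eq P * bet eq 0 (P ^ t) = bet eq 0 (P ^ t) * kap eq P := by
    intro t
    rw [map_zpow]
    exact (Commute.zpow_right hPP t)
  have c1 : ∀ (τ : TT F) (m k t : ℤ), chi τ ω = ω ^ m → m - 1 = (e + 1) * k →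
      kap eq P * X τ k t = X τ k t * kap eq P := by
    intro τ m k t hm hk
    simp only [hX]
    rw [← mul_assoc, hbP, mul_assoc, mul_assoc, r1 τ m k hm hk]
  have c2 : ∀ (τ : TT F) (k t : ℤ), chi τ l = l →
      bet eq 0 (GeneralLinearGroup.scalar _ l) * X τ k t =
        X τ k t * bet eq 0 (GeneralLinearGroup.scalar _ l) := by
    intro τ k t hl
    simp only [hX]
    rw [mul_assoc, r3 τ k hl, ← mul_assoc, ← mul_assoc, ← map_mul, ← map_mul,
      GeneralLinearGroup.scalar_commute]
  have c3 : X τ₁ k₁ t₁ * X τ₂ k₂ t₂ = X τ₂ k₂ t₂ * X τ₁ k₁ t₁ := by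
    simp only [hX]
    have L : ∀ (a b c d : MulAut (PS F ι)), a * b * (c * d) = a * (b * c) * d := by
      intro a b c d; group
    have L2 : ∀ (a b c d : MulAut (PS F ι)), a * (b * c) * d = (a * b) * (c * d) := by
      intro a b c d; group
    rw [L, r2 τ₁ m₁ k₁ h1 hk1, L2, r4, L (bet eq 0 (P ^ t₂)), r2 τ₂ m₂ k₂ h2 hk2, L2, ← map_mul,
      ← map_mul]
    congr 2
    have hs1 : ∀ (c : Fˣ) (x : GL (Fin (e + 1)) F), x * GeneralLinearGroup.scalar _ c =
      GeneralLinearGroup.scalar _ c * x := fun c x => (GeneralLinearGroup.scalar_commute c x).symm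
    rw [← _root_.zpow_mul, ← _root_.zpow_mul, ht, ← mul_assoc, ← mul_assoc, hs1, hs1, mul_assoc,
      mul_assoc, ← _root_.zpow_add, ← _root_.zpow_add, add_comm t₁]
  have hXform : ∀ (τ : TT F) (k t : ℤ), ∃ g : GL ι F, cL g * tL τ = X τ k t ∧
      GeneralLinearGroup.det g = ω ^ (t + s * k * (N + 1)) := by
    intro τ k t
    refine ⟨bd eq (Pi.mulSingle 0 (P ^ t)) * bd eq (fun _ => aa e (ω ^ k)), ?_, ?_⟩
    · simp only [hX, hα]; rw [map_mul, mul_assoc]; rfl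
    · rw [map_mul, det_bd, det_bd]
      simp only [hs, Finset.prod_const, Finset.card_univ, Fintype.card_fin]
      rw [Finset.prod_eq_single 0 (by intro b _ hb; simp [hb]) (by simp), Pi.mulSingle_eq_same,
        map_zpow, hdetP, ← _root_.zpow_mul, ← _root_.zpow_natCast, ← _root_.zpow_mul,
        ← _root_.zpow_add]
      congr 1
      push_cast
      ring
  refine ⟨s, Subgroup.closure {kap eq P, bet eq 0 (GeneralLinearGroup.scalar _ l), X τ₁ k₁ t₁,
    X τ₂ k₂ t₂}, comm_closure ?_, ?_, ?_, ?_, ?_⟩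
  · rintro x (rfl | rfl | rfl | rfl) y (rfl | rfl | rfl | rfl)
    · rfl
    · exact hPl l
    · exact c1 τ₁ m₁ k₁ t₁ h1 hk1
    · exact c1 τ₂ m₂ k₂ t₂ h2 hk2
    · exact (hPl l).symm
    · rfl
    · exact c2 τ₁ k₁ t₁ hl1
    · exact c2 τ₂ k₂ t₂ hl2
    · exact (c1 τ₁ m₁ k₁ t₁ h1 hk1).symm
    · exact (c2 τ₁ k₁ t₁ hl1).symm
    · rfl
    · exact c3
    · exact (c1 τ₂ m₂ k₂ t₂ h2 hk2).symm
    · exact (c2 τ₂ k₂ t₂ hl2).symm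
    · exact c3.symm
    · rfl
  · refine ⟨bd eq (fun _ => P), Subgroup.subset_closure (Or.inl rfl), ?_⟩
    rw [det_bd]
    simp [hdetP]
  · refine ⟨bd eq (Pi.mulSingle 0 (GeneralLinearGroup.scalar _ l)),
      Subgroup.subset_closure (Or.inr (Or.inl rfl)), ?_⟩
    rw [det_bd, Finset.prod_eq_single 0 (by intro b _ hb; simp [hb]) (by simp),
      Pi.mulSingle_eq_same, GeneralLinearGroup.det_scalar, Fintype.card_fin]
  · obtain ⟨g, hg, hd⟩ := hXform τ₁ k₁ t₁
    exact ⟨g, hg ▸ Subgroup.subset_closure (Or.inr (Or.inr (Or.inl rfl))), hd⟩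
  · obtain ⟨g, hg, hd⟩ := hXform τ₂ k₂ t₂
    exact ⟨g, hg ▸ Subgroup.subset_closure (Or.inr (Or.inr (Or.inr rfl))), hd⟩

end construct
end AbSup


namespace AbSup
open Matrix

lemma split_coprime (a b : ℕ) (hab : Nat.Coprime a b) (e : ℕ) (he : 0 < e) :
    ∃ e1 e2 : ℕ, e = e1 * e2 ∧ Nat.Coprime e1 e2 ∧ Nat.Coprime e1 a ∧ Nat.Coprime e2 b := by
  induction e using Nat.recOnPosPrimePosCoprime with
  | prime_pow p r hp hr =>
    by_cases h : p ∣ a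
    · refine ⟨1, p ^ r, by simp, by simp, by simp, ?_⟩
      apply Nat.Coprime.pow_left
      exact Nat.Coprime.coprime_dvd_left h hab
    · refine ⟨p ^ r, 1, by simp, by simp, ?_, by simp⟩
      apply Nat.Coprime.pow_left
      exact (Nat.Prime.coprime_iff_not_dvd hp).2 h
  | zero => exact absurd he (lt_irrefl _)
  | one => exact ⟨1, 1, by simp, by simp, by simp, by simp⟩
  | coprime x y hx hy hxy ihx ihy =>
    obtain ⟨x1, x2, rfl, h1, h2, h3⟩ := ihx (by omega)
    obtain ⟨y1, y2, rfl, g1, g2, g3⟩ := ihy (by omega)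
    refine ⟨x1 * y1, x2 * y2, by ring, ?_, Nat.Coprime.mul_left h2 g2, Nat.Coprime.mul_left h3 g3⟩
    have h12 : Nat.Coprime x1 y2 := Nat.Coprime.coprime_dvd_left (Dvd.intro _ rfl)
      (Nat.Coprime.coprime_dvd_right (Dvd.intro_left _ rfl) hxy)
    have h21 : Nat.Coprime y1 x2 := (Nat.Coprime.coprime_dvd_left (Dvd.intro_left _ rfl)
      (Nat.Coprime.coprime_dvd_right (Dvd.intro _ rfl) hxy)).symm
    exact Nat.Coprime.mul_left (Nat.Coprime.mul_right h1 h12) (Nat.Coprime.mul_right h21 g1)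

section finish
variable {F : Type*} [Field F]

lemma finish {n : ℕ} (d k e n' s' : ℕ) (hn : 0 < n) (hnd : n = d * n') (hd : d = k * e)
    (hs' : 0 < s') (hco : Nat.Coprime n' s') (ω : Fˣ) (hω : ω ^ (d * s') = 1)
    (τ₁ τ₂ : TT F) (hτ : τ₁ * τ₂ = τ₂ * τ₁) (m₁ m₂ c₁ c₂ t₁ t₂ : ℤ)
    (h1 : chi τ₁ ω = ω ^ m₁) (h2 : chi τ₂ ω = ω ^ m₂) (hc1 : m₁ = 1 + e * c₁)
    (hc2 : m₂ = 1 + e * c₂) (ht : c₁ * t₂ = c₂ * t₁) :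
    ∃ A : Subgroup (MulAut (PS F (Fin n))), (∀ x ∈ A, ∀ y ∈ A, x * y = y * x) ∧
      (∀ (g : GL (Fin n) F) (j : ℤ), GeneralLinearGroup.det g = ω ^ ((k : ℤ) * j) →
        cL g ∈ A ⊔ Inn F (Fin n)) ∧
      (∀ (g : GL (Fin n) F) (j : ℤ), GeneralLinearGroup.det g = ω ^ (t₁ + (k : ℤ) * j) →
        cL g * tL τ₁ ∈ A ⊔ Inn F (Fin n)) ∧
      (∀ (g : GL (Fin n) F) (j : ℤ), GeneralLinearGroup.det g = ω ^ (t₂ + (k : ℤ) * j) →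
        cL g * tL τ₂ ∈ A ⊔ Inn F (Fin n)) := by
  have hd0 : 0 < d := Nat.pos_of_ne_zero (by rintro rfl; simp at hnd; omega)
  have hn'0 : 0 < n' := Nat.pos_of_ne_zero (by rintro rfl; simp at hnd; omega)
  have hk0 : 0 < k := Nat.pos_of_ne_zero (by rintro rfl; simp at hd; omega)
  have he0 : 0 < e := Nat.pos_of_ne_zero (by rintro rfl; simp at hd; omega)
  obtain ⟨e1, e2, he, h12, h1n, h2s⟩ := split_coprime n' s' hco e he0
  have he10 : 0 < e1 := Nat.pos_of_ne_zero (by rintro rfl; simp at he; omega)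
  have he20 : 0 < e2 := Nat.pos_of_ne_zero (by rintro rfl; simp at he; omega)
  obtain ⟨E, rfl⟩ : ∃ E, e1 = E + 1 := ⟨e1 - 1, by omega⟩
  obtain ⟨N, hN⟩ : ∃ N, k * e2 * n' = N + 1 :=
    ⟨k * e2 * n' - 1, by have : 0 < k * e2 * n' := by positivity
                         omega⟩
  have hnN : (E + 1) * (N + 1) = n := by rw [← hN, hnd, hd, he]; ring
  let eq : Fin (E + 1) × Fin (N + 1) ≃ Fin n := finProdFinEquiv.trans (finCongr hnN)
  set l : Fˣ := ω ^ (k * (E + 1) * s') with hl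
  have hle : l ^ e2 = 1 := by
    rw [hl, ← pow_mul, ← hω]; congr 1; rw [hd, he]; ring
  have hlf : ∀ (τ : TT F) (m c : ℤ), chi τ ω = ω ^ m → m = 1 + e * c → chi τ l = l := by
    intro τ m c hm hc
    have e0 : chi τ l = l ^ m := by
      rw [hl, map_pow, hm, ← _root_.zpow_natCast, ← _root_.zpow_natCast, zpow_comm]
    have e1 : m = 1 + (e2 : ℤ) * ((E + 1) * c) := by rw [hc, he]; push_cast; ring
    rw [e0, e1, _root_.zpow_add, _root_.zpow_mul, _root_.zpow_natCast, hle]; simp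
  obtain ⟨s, A, hA, ⟨g1, hg1, hd1⟩, ⟨g2, hg2, hd2⟩, ⟨x1, hx1, hdx1⟩, ⟨x2, hx2, hdx2⟩⟩ :=
    construct E N eq ω l τ₁ τ₂ hτ m₁ m₂ (e2 * c₁) (e2 * c₂) t₁ t₂ h1 h2
      (by rw [hc1, he]; push_cast; ring) (by rw [hc2, he]; push_cast; ring)
      (hlf τ₁ m₁ c₁ h1 hc1) (hlf τ₂ m₂ c₂ h2 hc2) (by rw [mul_assoc, ht, mul_assoc])
  have hone : ∀ g : GL (Fin n) F, GeneralLinearGroup.det g = 1 → cL g ∈ A ⊔ Inn F (Fin n) := by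
    intro g hg
    exact (le_sup_right : _ ≤ A ⊔ Inn F (Fin n)) (inn_of_det (u := 1) (by rw [hg, one_pow]))
  have hAB : A ≤ A ⊔ Inn F (Fin n) := le_sup_left
  have hcop : Nat.Coprime (e2 * n') ((E + 1) * (E + 1) * s') := by
    apply Nat.Coprime.mul_left
    · exact Nat.Coprime.mul_right (Nat.Coprime.mul_right h12.symm h12.symm) h2s
    · exact Nat.Coprime.mul_right (Nat.Coprime.mul_right h1n.symm h1n.symm) hco
  have hbez : ((e2 * n' : ℕ) : ℤ) * Nat.gcdA (e2 * n') ((E + 1) * (E + 1) * s') +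
      (((E + 1) * (E + 1) * s' : ℕ) : ℤ) * Nat.gcdB (e2 * n') ((E + 1) * (E + 1) * s') = 1 := by
    rw [← Nat.gcd_eq_gcd_ab, hcop]; rfl
  generalize Nat.gcdA (e2 * n') ((E + 1) * (E + 1) * s') = u at hbez
  generalize Nat.gcdB (e2 * n') ((E + 1) * (E + 1) * s') = v at hbez
  have hK : ∀ (g : GL (Fin n) F) (j : ℤ), GeneralLinearGroup.det g = ω ^ ((k : ℤ) * j) →
        cL g ∈ A ⊔ Inn F (Fin n) := by
    intro g j hg
    have hdet : GeneralLinearGroup.det (g1 ^ (u * j) * g2 ^ (v * j)) = ω ^ ((k : ℤ) * j) := by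
      rw [map_mul, map_zpow, map_zpow, hd1, hd2, hl, ← pow_mul, ← _root_.zpow_natCast,
        ← _root_.zpow_natCast, ← _root_.zpow_mul, ← _root_.zpow_mul, ← _root_.zpow_add]
      congr 1
      rw [← hN]
      push_cast at hbez ⊢
      linear_combination (k : ℤ) * j * hbez
    have : g = g * (g1 ^ (u * j) * g2 ^ (v * j))⁻¹ * (g1 ^ (u * j) * g2 ^ (v * j)) := by group
    rw [this, map_mul]
    apply mul_mem
    · apply hone
      rw [map_mul, map_inv, hdet, hg, mul_inv_cancel]
    · rw [map_mul, map_zpow, map_zpow]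
      exact mul_mem (zpow_mem (hAB hg1) _) (zpow_mem (hAB hg2) _)
  have hT : ∀ (τ : TT F) (x : GL (Fin n) F) (t c : ℤ), cL x * tL τ ∈ A →
      GeneralLinearGroup.det x = ω ^ (t + s * (e2 * c) * (N + 1)) →
      ∀ (g : GL (Fin n) F) (j : ℤ), GeneralLinearGroup.det g = ω ^ (t + (k : ℤ) * j) →
        cL g * tL τ ∈ A ⊔ Inn F (Fin n) := by
    intro τ x t c hx hdx g j hg
    have : cL g * tL τ = cL (g * x⁻¹) * (cL x * tL τ) := by
      rw [← mul_assoc, ← map_mul]; congr 2; group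
    rw [this]
    refine mul_mem (hK _ (j - s * (e2 * c) * (e2 * n')) ?_) (hAB hx)
    rw [map_mul, map_inv, hg, hdx, ← _root_.zpow_neg, ← _root_.zpow_add]
    congr 1
    have : ((N : ℤ) + 1) = k * e2 * n' := by exact_mod_cast hN.symm
    rw [this]; ring
  exact ⟨A, hA, hK, hT τ₁ x1 t₁ c₁ hx1 hdx1, hT τ₂ x2 t₂ c₂ hx2 hdx2⟩

end finish
end AbSup


namespace AbSup
open Matrix

lemma ringAut_cyclic (F : Type*) [Field F] [Finite F] : IsCyclic (RingAut F) := by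
  obtain ⟨p, hp⟩ := CharP.exists F
  haveI : Fact p.Prime := ⟨(CharP.char_is_prime F p)⟩
  letI : Algebra (ZMod p) F := ZMod.algebra F p
  let f : RingAut F →* (F ≃ₐ[ZMod p] F) :=
    { toFun := fun σ => AlgEquiv.ofRingEquiv (f := σ) (fun x => by
        have : ((σ : F →+* F).comp (algebraMap (ZMod p) F)) = algebraMap (ZMod p) F :=
          Subsingleton.elim _ _
        exact congrFun (congrArg DFunLike.coe this) x)
      map_one' := by ext; rfl
      map_mul' := by intro a b; ext; rfl }
  have hf : Function.Injective f := by
    intro a b hab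
    apply RingEquiv.ext
    intro x
    exact congrArg (fun h : F ≃ₐ[ZMod p] F => h x) hab
  haveI : Finite F := inferInstance
  exact isCyclic_of_injective f hf

lemma prod_struct {C : Type*} [Group C] [IsCyclic C] (E : Subgroup (C × ℤˣ)) :
    (∃ τ ∈ E, ∀ x ∈ E, ∃ k : ℤ, x = τ ^ k) ∨
    (∃ σ : C, (σ, (1 : ℤˣ)) ∈ E ∧ ((1 : C), (-1 : ℤˣ)) ∈ E ∧
      ∀ x ∈ E, ∃ a b : ℤ, x = (σ, (1 : ℤˣ)) ^ a * ((1 : C), (-1 : ℤˣ)) ^ b) := by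
  by_cases h : ((1 : C), (-1 : ℤˣ)) ∈ E
  · right
    let M : Subgroup C := E.map (MonoidHom.fst C ℤˣ)
    obtain ⟨⟨σ, hσ⟩, hgen⟩ := IsCyclic.exists_generator (α := M)
    have hσE : (σ, (1 : ℤˣ)) ∈ E := by
      obtain ⟨⟨a, b⟩, hy, hyσ⟩ := hσ
      simp only [MonoidHom.coe_fst] at hyσ
      subst hyσ
      rcases Int.units_eq_one_or b with rfl | rfl
      · exact hy
      · have := E.mul_mem hy h
        simpa using this
    refine ⟨σ, hσE, h, ?_⟩
    rintro ⟨a, b⟩ hx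
    obtain ⟨k, hk⟩ := Subgroup.mem_zpowers_iff.1 (hgen ⟨a, ⟨(a, b), hx, rfl⟩⟩)
    have hk' : σ ^ k = a := congrArg Subtype.val hk
    rcases Int.units_eq_one_or b with rfl | rfl
    · exact ⟨k, 0, by simp [← hk']⟩
    · exact ⟨k, 1, by simp [← hk']⟩
  · left
    have hinj : Function.Injective ((MonoidHom.fst C ℤˣ).comp E.subtype) := by
      rw [injective_iff_map_eq_one]
      rintro ⟨⟨a, b⟩, hx⟩ ha
      simp at ha
      subst ha
      rcases Int.units_eq_one_or b with rfl | rfl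
      · rfl
      · exact absurd hx h
    haveI := isCyclic_of_injective _ hinj
    obtain ⟨⟨τ, hτ⟩, hgen⟩ := IsCyclic.exists_generator (α := E)
    refine ⟨τ, hτ, fun x hx => ?_⟩
    obtain ⟨k, hk⟩ := Subgroup.mem_zpowers_iff.1 (hgen ⟨x, hx⟩)
    exact ⟨k, (congrArg Subtype.val hk).symm⟩

section core
variable {F : Type*} [Field F] {ι : Type*} [Fintype ι] [DecidableEq ι]

variable (F ι) in
/-- pairs of an automorphism and its class -/
def SS : Subgroup (MulAut (PS F ι) × TT F) where
  carrier := {p | ∃ g : GL ι F, p.1 = cL g * tL p.2}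
  one_mem' := ⟨1, by simp⟩
  mul_mem' := by
    rintro ⟨a, τ⟩ ⟨b, τ'⟩ ⟨g, hg⟩ ⟨g', hg'⟩
    refine ⟨g * theta τ g', ?_⟩
    simp only at hg hg'
    simp only [Prod.mk_mul_mk]
    rw [hg, hg', map_mul, map_mul, mul_assoc, ← mul_assoc (tL τ), tL_cL]
    simp only [mul_assoc]
  inv_mem' := by
    rintro ⟨a, τ⟩ ⟨g, hg⟩
    refine ⟨theta τ⁻¹ g⁻¹, ?_⟩
    simp only at hg
    simp only [Prod.inv_mk]
    rw [hg, ← tL_cL, _root_.mul_inv_rev, map_inv, map_inv]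

lemma wrap (H B : Subgroup (MulAut (PS F ι)))
    (F1 : ∀ α : MulAut (PS F ι), ∃ (g : GL ι F) (τ : TT F), α = cL g * tL τ)
    (x₁ x₂ : MulAut (PS F ι)) (τ₁ τ₂ : TT F) (h1 : x₁ ∈ H) (h2 : x₂ ∈ H) (b1 : x₁ ∈ B)
    (b2 : x₂ ∈ B) (s1 : (x₁, τ₁) ∈ SS F ι) (s2 : (x₂, τ₂) ∈ SS F ι)
    (hE : ∀ (τ : TT F) (g : GL ι F), cL g * tL τ ∈ H → ∃ a b : ℤ, τ = τ₁ ^ a * τ₂ ^ b)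
    (hI : ∀ g : GL ι F, cL g ∈ H → cL g ∈ B) : H ≤ B := by
  intro α hα
  obtain ⟨g, τ, rfl⟩ := F1 α
  obtain ⟨a, b, rfl⟩ := hE τ g hα
  have hs : (x₁ ^ a * x₂ ^ b, τ₁ ^ a * τ₂ ^ b) ∈ SS F ι :=
    (SS F ι).mul_mem ((SS F ι).zpow_mem s1 a) ((SS F ι).zpow_mem s2 b)
  obtain ⟨g', hg'⟩ := hs
  simp only at hg'
  have e : cL (g * g'⁻¹) = (cL g * tL (τ₁ ^ a * τ₂ ^ b)) * (x₁ ^ a * x₂ ^ b)⁻¹ := by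
    rw [hg', map_mul, map_inv]; group
  have hH : cL (g * g'⁻¹) ∈ H := by
    rw [e]
    exact mul_mem hα (inv_mem (mul_mem (zpow_mem h1 a) (zpow_mem h2 b)))
  have hB := hI _ hH
  rw [e] at hB
  have := mul_mem hB (mul_mem (zpow_mem b1 a) (zpow_mem b2 b))
  rwa [inv_mul_cancel_right] at this

lemma constr {H : Subgroup (MulAut (PS F ι))}
    (hT : ∀ τ τ' : TT F, τ * τ' = τ' * τ)
    (hH : ∀ α ∈ H, ∀ β ∈ H, ∃ s, α * β = MulAut.conj s * (β * α))
    {g g' : GL ι F} {τ τ' : TT F} (h : cL g * tL τ ∈ H) (h' : cL g' * tL τ' ∈ H) :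
    ∃ u : Fˣ, GeneralLinearGroup.det g * chi τ (GeneralLinearGroup.det g') =
      GeneralLinearGroup.det g' * chi τ' (GeneralLinearGroup.det g) * u ^ Fintype.card ι := by
  have key : ∀ (g g' : GL ι F) (τ τ' : TT F), cL g * tL τ * (cL g' * tL τ') =
      cL (g * theta τ g') * tL (τ * τ') := by
    intro g g' τ τ'
    rw [map_mul, map_mul, mul_assoc, ← mul_assoc (tL τ), tL_cL]
    simp only [mul_assoc]
  obtain ⟨s, hs⟩ := hH _ h _ h'
  rw [key, key, hT τ' τ, ← mul_assoc] at hs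
  have hs' := mul_right_cancel hs
  have : cL (g * theta τ g' * (g' * theta τ' g)⁻¹) = MulAut.conj s := by
    rw [map_mul, hs', map_inv, mul_inv_cancel_right]
  obtain ⟨u, hu⟩ := det_of_inn this
  refine ⟨u, ?_⟩
  rw [map_mul, map_inv, map_mul, map_mul, det_theta, det_theta, mul_inv_eq_iff_eq_mul] at hu
  rw [hu, mul_comm]

end core
end AbSup


namespace AbSup
open Matrix

section core
variable {F : Type*} [Field F] [Finite F]

lemma core {n : ℕ} (hn : 0 < n)
    (F1 : ∀ α : MulAut (PS F (Fin n)), ∃ (g : GL (Fin n) F) (τ : TT F), α = cL g * tL τ)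
    (H : Subgroup (MulAut (PS F (Fin n))))
    (hH : ∀ α ∈ H, ∀ β ∈ H, ∃ s, α * β = MulAut.conj s * (β * α)) :
    ∃ A : Subgroup (MulAut (PS F (Fin n))), (∀ x ∈ A, ∀ y ∈ A, x * y = y * x) ∧
      H ≤ A ⊔ Inn F (Fin n) := by
  have hcyc := ringAut_cyclic F
  have hT : ∀ τ τ' : TT F, τ * τ' = τ' * τ := by
    rintro ⟨a, b⟩ ⟨a', b'⟩
    letI : CommGroup (RingAut F) := IsCyclic.commGroup
    exact Prod.ext (mul_comm a a') (mul_comm b b')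
  obtain ⟨ω, hω⟩ := IsCyclic.exists_generator (α := Fˣ)
  have hexp : ∀ u : Fˣ, ∃ i : ℤ, u = ω ^ i := fun u => by
    obtain ⟨i, hi⟩ := Subgroup.mem_zpowers_iff.1 (hω u)
    exact ⟨i, hi.symm⟩
  set Q := orderOf ω with hQ
  have hQ0 : 0 < Q := orderOf_pos ω
  obtain ⟨d, hd⟩ : ∃ d, d = Nat.gcd n Q := ⟨_, rfl⟩
  have hd0 : 0 < d := hd ▸ Nat.gcd_pos_of_pos_left _ hn
  obtain ⟨n', s', hco, hnd, hQd⟩ := Nat.exists_coprime n Q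
  rw [← hd] at hnd hQd
  have hs' : 0 < s' := Nat.pos_of_ne_zero (by rintro rfl; simp at hQd; omega)
  have hω1 : ω ^ (d * s') = 1 := by rw [mul_comm, ← hQd]; exact pow_orderOf_eq_one ω
  have hnd' : n = d * n' := by rw [mul_comm]; exact hnd
  have npow : ∀ (i j : ℤ) (u : Fˣ), ω ^ i = ω ^ j * u ^ Fintype.card (Fin n) → (d : ℤ) ∣ i - j := by
    intro i j u h
    obtain ⟨c, rfl⟩ := hexp u
    rw [Fintype.card_fin, ← _root_.zpow_natCast, ← _root_.zpow_mul, ← _root_.zpow_add] at h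
    have h2 : (Q : ℤ) ∣ i - (j + c * n) := by
      rw [hQ, orderOf_dvd_iff_zpow_eq_one, _root_.zpow_sub, h, mul_inv_cancel]
    have h3 : (d : ℤ) ∣ i - (j + c * n) := by
      refine dvd_trans ?_ h2
      rw [hQd]; push_cast; exact Dvd.intro_left _ rfl
    have h4 : (d : ℤ) ∣ c * n := by
      rw [hnd']; push_cast; exact ⟨c * n', by ring⟩
    have := dvd_add h3 h4
    have e : i - (j + c * n) + c * n = i - j := by ring
    rwa [e] at this
  have con : ∀ {g g' : GL (Fin n) F} {τ τ' : TT F} {i j m m' : ℤ}, cL g * tL τ ∈ H →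
      cL g' * tL τ' ∈ H → GeneralLinearGroup.det g = ω ^ i → GeneralLinearGroup.det g' = ω ^ j →
      chi τ ω = ω ^ m → chi τ' ω = ω ^ m' → (d : ℤ) ∣ (m - 1) * j - (m' - 1) * i := by
    intro g g' τ τ' i j m m' h h' hi hj hm hm'
    obtain ⟨u, hu⟩ := constr hT hH h h'
    rw [hi, hj, map_zpow, map_zpow, hm, hm', ← _root_.zpow_mul, ← _root_.zpow_mul,
      ← _root_.zpow_add, ← _root_.zpow_add] at hu
    have := npow _ _ _ hu
    have e : i + m * j - (j + m' * i) = (m - 1) * j - (m' - 1) * i := by ring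
    rwa [e] at this
  -- the classes
  let E : Subgroup (TT F) :=
    { carrier := {τ | ∃ α ∈ H, (α, τ) ∈ SS F (Fin n)}
      one_mem' := ⟨1, one_mem _, one_mem _⟩
      mul_mem' := by
        rintro a b ⟨α, h1, h2⟩ ⟨β, h3, h4⟩
        exact ⟨α * β, mul_mem h1 h3, (SS F (Fin n)).mul_mem h2 h4⟩
      inv_mem' := by
        rintro a ⟨α, h1, h2⟩
        exact ⟨α⁻¹, inv_mem h1, (SS F (Fin n)).inv_mem h2⟩ }
  have hEm : ∀ (τ : TT F) (g : GL (Fin n) F), cL g * tL τ ∈ H → τ ∈ E :=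
    fun τ g h => ⟨_, h, g, rfl⟩
  have chione : ∀ u : Fˣ, chi (1 : TT F) u = u := by
    intro u
    have := chi_one (1 : RingAut F) u
    exact this.trans (Units.ext rfl)
  rcases prod_struct E with ⟨τ, ⟨x, hxH, g1, hg1⟩, hgen⟩ | ⟨σ, ⟨x, hxH, a, hxa⟩, ⟨y, hyH, b, hyb⟩, hgen⟩
  · simp only at hg1
    obtain ⟨i1, hi1⟩ := hexp (GeneralLinearGroup.det g1)
    obtain ⟨m, hm⟩ := hexp (chi τ ω)
    let I : AddSubgroup ℤ :=
      { carrier := {i | ∃ (g : GL (Fin n) F) (c : ℤ), cL g ∈ H ∧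
          GeneralLinearGroup.det g = ω ^ (i + d * c)}
        zero_mem' := ⟨1, 0, by rw [map_one]; exact one_mem _, by simp⟩
        add_mem' := by
          rintro i j ⟨g, c, h1, h2⟩ ⟨g', c', h1', h2'⟩
          refine ⟨g * g', c + c', by rw [map_mul]; exact mul_mem h1 h1', ?_⟩
          rw [map_mul, h2, h2', ← _root_.zpow_add]; congr 1; ring
        neg_mem' := by
          rintro i ⟨g, c, h1, h2⟩
          refine ⟨g⁻¹, -c, by rw [map_inv]; exact inv_mem h1, ?_⟩
          rw [map_inv, h2, ← _root_.zpow_neg]; congr 1; ring }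
    obtain ⟨k0, hk0⟩ := Int.subgroup_cyclic I
    have hmemI : ∀ i, i ∈ I ↔ (k0.natAbs : ℤ) ∣ i := by
      intro i
      rw [hk0, AddSubgroup.mem_closure_singleton, Int.natAbs_dvd]
      constructor
      · rintro ⟨c, rfl⟩; exact ⟨c, by simp [mul_comm]⟩
      · rintro ⟨c, rfl⟩; exact ⟨c, by simp [mul_comm]⟩
    set k := k0.natAbs with hk
    have hdI : (d : ℤ) ∈ I := ⟨1, -1, by rw [map_one]; exact one_mem _, by simp⟩
    have hkd : k ∣ d := by exact_mod_cast (hmemI _).1 hdI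
    obtain ⟨e, hde⟩ := hkd
    have hkpos : 0 < k := Nat.pos_of_ne_zero (by intro h; rw [h] at hde; simp at hde; omega)
    have hdm : (d : ℤ) ∣ (m - 1) * k := by
      obtain ⟨g, c, h1, h2⟩ := (hmemI k).2 dvd_rfl
      have h1' : cL g * tL 1 ∈ H := by simpa using h1
      have := con (hg1 ▸ hxH) h1' hi1 h2 hm (m' := 1) (by rw [chione]; simp)
      have h3 : (d : ℤ) ∣ (m - 1) * (d * c) := ⟨(m - 1) * c, by ring⟩
      have h4 := dvd_sub this h3
      have e : (m - 1) * (k + d * c) - (1 - 1) * i1 - (m - 1) * (d * c) = (m - 1) * k := by ring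
      rwa [e] at h4
    have hem : (e : ℤ) ∣ m - 1 := by
      rw [hde, mul_comm (m - 1)] at hdm
      push_cast at hdm
      exact Int.dvd_of_mul_dvd_mul_left (by positivity) hdm
    obtain ⟨c, hc⟩ := hem
    obtain ⟨A, hA, hA1, hA2, -⟩ := finish d k e n' s' hn hnd' hde hs' hco ω hω1 τ 1 (hT _ _) m 1 c 0
      i1 0 hm (by rw [chione]; simp) (by linarith) (by simp) (by simp)
    refine ⟨A, hA, wrap H _ F1 x 1 τ 1 hxH (one_mem _) ?_ (one_mem _) ⟨g1, hg1⟩ (one_mem _) ?_ ?_⟩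
    · rw [hg1]
      exact hA2 g1 0 (by rw [hi1]; simp)
    · intro τ' g h
      obtain ⟨j, hj⟩ := hgen τ' (hEm τ' g h)
      exact ⟨j, 0, by simp [hj]⟩
    · intro g hg
      obtain ⟨i, hi⟩ := hexp (GeneralLinearGroup.det g)
      have : i ∈ I := ⟨g, 0, hg, by simpa using hi⟩
      obtain ⟨j, hj⟩ := (hmemI i).1 this
      exact hA1 g j (by rw [hi, hj])
  · simp only at hxa hyb
    obtain ⟨i, hi⟩ := hexp (GeneralLinearGroup.det a)
    obtain ⟨j, hj⟩ := hexp (GeneralLinearGroup.det b)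
    obtain ⟨m, hm⟩ := hexp (chi (σ, 1) ω)
    have hm2 : chi ((1 : RingAut F), (-1 : ℤˣ)) ω = ω ^ (-1 : ℤ) := by
      rw [chi_neg, _root_.zpow_neg_one]; congr 1
    have cxy := con (hxa ▸ hxH) (hyb ▸ hyH) hi hj hm hm2
    have cg : ∀ (g : GL (Fin n) F) (l : ℤ), cL g ∈ H → GeneralLinearGroup.det g = ω ^ l →
        (d : ℤ) ∣ 2 * l := by
      intro g l h hl
      have h1' : cL g * tL 1 ∈ H := by simpa using h
      have := con (hyb ▸ hyH) h1' hj hl hm2 (m' := 1) (by rw [chione]; simp)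
      have e : (-1 - 1) * l - (1 - 1) * j = - (2 * l) := by ring
      rw [e] at this
      exact (dvd_neg.1 this)
    -- reduction to divisibility
    have red : ∀ (k e : ℕ) (c₁ c₂ t₁ t₂ : ℤ), d = k * e → m = 1 + e * c₁ → -1 = 1 + (e : ℤ) * c₂ →
        c₁ * t₂ = c₂ * t₁ → (k : ℤ) ∣ i - t₁ → (k : ℤ) ∣ j - t₂ →
        (∀ l : ℤ, (d : ℤ) ∣ 2 * l → (k : ℤ) ∣ l) →
        ∃ A : Subgroup (MulAut (PS F (Fin n))), (∀ x ∈ A, ∀ y ∈ A, x * y = y * x) ∧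
          H ≤ A ⊔ Inn F (Fin n) := by
      intro k e c₁ c₂ t₁ t₂ hde h1 h2 h3 ⟨u, hu⟩ ⟨v, hv⟩ h4
      obtain ⟨A, hA, hA1, hA2, hA3⟩ := finish d k e n' s' hn hnd' hde hs' hco ω hω1 (σ, 1) (1, -1)
        (hT _ _) m (-1) c₁ c₂ t₁ t₂ hm hm2 h1 h2 h3
      refine ⟨A, hA, wrap H _ F1 x y (σ, 1) (1, -1) hxH hyH ?_ ?_ ⟨a, hxa⟩ ⟨b, hyb⟩ ?_ ?_⟩
      · rw [hxa]
        exact hA2 a u (by rw [hi]; congr 1; linarith)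
      · rw [hyb]
        exact hA3 b v (by rw [hj]; congr 1; linarith)
      · intro τ' g h
        exact hgen τ' (hEm τ' g h)
      · intro g hg
        obtain ⟨l, hl⟩ := hexp (GeneralLinearGroup.det g)
        obtain ⟨w, hw⟩ := h4 l (cg g l hg hl)
        exact hA1 g w (by rw [hl, hw])
    rcases Nat.even_or_odd' d with ⟨r, hr | hr⟩
    · -- even case
      have hmodd : ¬ (2 : ℤ) ∣ m := by
        rintro ⟨c, hc⟩
        have h1 : chi (σ, 1) (ω ^ (r * s')) = 1 := by
          rw [map_pow, hm, hc, ← _root_.zpow_natCast, ← _root_.zpow_mul]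
          have : 2 * c * ((r * s' : ℕ) : ℤ) = ((d * s' : ℕ) : ℤ) * c := by
            rw [hr]; push_cast; ring
          rw [this, _root_.zpow_mul, _root_.zpow_natCast, hω1, _root_.one_zpow]
        have h2 : ω ^ (r * s') = 1 := by
          rw [chi_one] at h1
          apply Units.ext
          have h3 := congrArg Units.val h1
          exact σ.injective (h3.trans (map_one σ).symm)
        have h3 := Nat.le_of_dvd (by have : 0 < r := by omega
                                     positivity) (orderOf_dvd_of_pow_eq_one h2)
        rw [← hQ, hQd, hr] at h3
        have : 0 < s' * r := by have : 0 < r := by omega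
                                positivity
        nlinarith
      obtain ⟨c, hc⟩ : ∃ c, m = 1 + 2 * c := ⟨(m - 1) / 2, by omega⟩
      refine red r 2 c (-1) (-(c * j)) j (by omega) (by rw [hc]; simp) (by simp) (by ring) ?_ ?_ ?_
      · rw [hr, hc] at cxy
        push_cast at cxy
        have e : (1 + 2 * c - 1) * j - -2 * i = 2 * (i - -(c * j)) := by ring
        rw [e] at cxy
        exact Int.dvd_of_mul_dvd_mul_left (by norm_num) cxy
      · simp
      · intro l hl
        rw [hr] at hl
        push_cast at hl
        exact Int.dvd_of_mul_dvd_mul_left (by norm_num) hl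
    · have h2l : ∀ l : ℤ, (d : ℤ) ∣ 2 * l → (d : ℤ) ∣ l := by
        intro l hl
        have e : l = d * l - 2 * l * r := by rw [hr]; push_cast; ring
        rw [e]
        exact dvd_sub (Dvd.intro _ rfl) (Dvd.dvd.mul_right hl _)
      refine red d 1 (m - 1) (-2) (-((m - 1) * ((r + 1) * j))) (2 * ((r + 1) * j)) (by simp)
        (by simp) (by simp) (by ring) ?_ ?_ h2l
      · apply h2l
        have e : 2 * (i - -((m - 1) * ((r + 1) * j))) =
          ((m - 1) * j - (-1 - 1) * i) + d * ((m - 1) * j) := by rw [hr]; push_cast; ring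
        rw [e]
        exact dvd_add cxy (Dvd.intro _ rfl)
      · exact ⟨-j, by rw [hr]; push_cast; ring⟩

end core
end AbSup


namespace AbSup
open Matrix

lemma glue {F : Type*} [Field F] [Finite F] {n : ℕ} (hn : 0 < n)
    (F1 : ∀ α : MulAut (PS F (Fin n)), ∃ (g : GL (Fin n) F) (τ : TT F), α = cL g * tL τ)
    (G : Type*) [Group G] (G₀ : Subgroup G) [G₀.Normal]
    (hcent : Subgroup.centralizer (G₀ : Set G) = ⊥) (e : G₀ ≃* PS F (Fin n))
    (hab : ∀ x y : G ⧸ G₀, x * y = y * x) :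
    ∃ A : Subgroup G, (∀ x y : A, (x : G) * y = (y : G) * x) ∧ A ⊔ G₀ = ⊤ := by
  let ψ : G →* MulAut (PS F (Fin n)) :=
    ((MulAut.congr e).toMonoidHom).comp (MulAut.conjNormal : G →* MulAut G₀)
  have hψ : ∀ (g : G) (x : G₀), ψ g (e x) = e (MulAut.conjNormal g x) := by
    intro g x
    simp [ψ]
  have hψ0 : ∀ s : G₀, ψ (s : G) = MulAut.conj (e s) := by
    intro s
    apply MulEquiv.ext
    intro y
    obtain ⟨x, rfl⟩ := e.surjective y
    rw [hψ, MulAut.conj_apply, ← map_inv, ← map_mul, ← map_mul]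
    congr 1
  have hinj : Function.Injective ψ := by
    rw [injective_iff_map_eq_one]
    intro g hg
    have : g ∈ Subgroup.centralizer (G₀ : Set G) := by
      rw [Subgroup.mem_centralizer_iff]
      intro h hh
      have h1 := hψ g ⟨h, hh⟩
      rw [hg] at h1
      have h2 := congrArg Subtype.val (e.injective h1)
      rw [MulAut.conjNormal_apply] at h2
      simp only at h2
      rw [eq_mul_inv_iff_mul_eq] at h2
      exact h2
    rw [hcent] at this
    exact Subgroup.mem_bot.1 this
  obtain ⟨A, hA, hle⟩ := core hn F1 ψ.range (by
    rintro _ ⟨g, rfl⟩ _ ⟨h, rfl⟩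
    have h1 := hab (g : G ⧸ G₀) (h : G ⧸ G₀)
    have h2 : g * h * (h * g)⁻¹ ∈ G₀ := by
      have : ((g * h * (h * g)⁻¹ : G) : G ⧸ G₀) = 1 := by
        rw [QuotientGroup.mk_mul, QuotientGroup.mk_inv, QuotientGroup.mk_mul, QuotientGroup.mk_mul,
          h1, mul_inv_cancel]
      exact (QuotientGroup.eq_one_iff _).1 this
    refine ⟨e ⟨_, h2⟩, ?_⟩
    rw [← hψ0, ← map_mul, ← map_mul, ← map_mul]
    congr 1
    simp only
    group)
  refine ⟨A.comap ψ, ?_, ?_⟩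
  · rintro ⟨x, hx⟩ ⟨y, hy⟩
    apply hinj
    simp only
    rw [map_mul, map_mul]
    exact hA _ hx _ hy
  · rw [eq_top_iff]
    intro g _
    have h1 := hle ⟨g, rfl⟩
    haveI : (Inn F (Fin n)).Normal := by
      constructor
      rintro _ ⟨s, rfl⟩ α
      refine ⟨α s, ?_⟩
      apply MulEquiv.ext
      intro x
      simp [MulAut.mul_apply]
    rw [Subgroup.mem_sup_of_normal_right] at h1
    obtain ⟨a, ha, _, ⟨s, rfl⟩, has⟩ := h1
    obtain ⟨s0, rfl⟩ := e.surjective s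
    rw [← hψ0] at has
    have h2 : g * (s0 : G)⁻¹ ∈ A.comap ψ := by
      rw [Subgroup.mem_comap, map_mul, map_inv, ← has, mul_inv_cancel_right]
      exact ha
    have h3 := Subgroup.mul_mem_sup h2 s0.2
    rwa [inv_mul_cancel_right] at h3

end AbSup


namespace AbSup
open Matrix

section gen
variable {F : Type*} [Field F] {ι : Type*} [Fintype ι] [DecidableEq ι]

lemma pr_unip [Nonempty ι] {A B : Matrix.SpecialLinearGroup ι F}
    (hA : (A.val - 1) * (A.val - 1) = 0) (hB : (B.val - 1) * (B.val - 1) = 0) (h : pr A = pr B) :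
    A = B := by
  obtain ⟨z, -, hz⟩ := (pr_eq_iff A B).1 h
  have h1 := unip_scalar hA hB hz
  rw [h1, one_smul] at hz
  exact Subtype.ext hz

lemma tv_sq {i j : ι} (hij : i ≠ j) (a : F) : ((tv hij a).val - 1) * ((tv hij a).val - 1) = 0 := by
  rw [tv_val, add_sub_cancel_left, Matrix.single_mul_single_of_ne]; exact hij.symm

lemma tv_inj {i j : ι} (hij : i ≠ j) {a b : F} (h : pr (tv hij a) = pr (tv hij b)) : a = b := by
  haveI : Nonempty ι := ⟨i⟩
  have h1 := congrArg Subtype.val (pr_unip (tv_sq hij a) (tv_sq hij b) h)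
  rw [tv_val, tv_val] at h1
  have h3 : Matrix.single i j a = Matrix.single i j b := add_left_cancel h1
  have h2 := congrFun (congrFun h3 i) j
  simpa using h2

lemma dg_conj (u : ι → Fˣ) {i j : ι} (hij : i ≠ j) (a : F) :
    resSL (cD (dg u)) (tv hij a) = tv hij (u i * a * ((u j)⁻¹ : Fˣ)) := by
  apply Subtype.ext
  rw [resSL_cD_val, tv_val, tv_val, mul_add, add_mul, mul_one, Units.mul_inv]
  congr 1
  rw [← map_inv]
  change diagonal (fun i => (u i : F)) * Matrix.single i j a *
    diagonal (fun i => ((u⁻¹ i : Fˣ) : F)) = _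
  ext k l
  rw [mul_diagonal, diagonal_mul]
  by_cases h1 : i = k
  · by_cases h2 : j = l
    · subst h1 h2; simp
    · simp [h2]
  · simp [h1]

lemma fix_one (β : MulAut (PS F ι))
    (h : ∀ (i j : ι) (hij : i ≠ j) (a : F), β (pr (tv hij a)) = pr (tv hij a)) : β = 1 := by
  let K : Subgroup (Matrix.SpecialLinearGroup ι F) :=
    { carrier := {A | β (pr A) = pr A}
      one_mem' := by simp
      mul_mem' := by
        intro a b ha hb
        simp only [Set.mem_ofPred_eq] at *
        rw [map_mul, map_mul, ha, hb]
      inv_mem' := by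
        intro a ha
        simp only [Set.mem_ofPred_eq] at *
        rw [map_inv, map_inv, ha] }
  have hdiag : ∀ (D : ι → F) (hD : det (diagonal D) = 1),
      (⟨diagonal D, hD⟩ : Matrix.SpecialLinearGroup ι F) ∈ K := by
    intro D hD
    have hne : ∀ i, D i ≠ 0 := by
      intro i hi
      rw [det_diagonal, Finset.prod_eq_zero (Finset.mem_univ i) hi] at hD
      exact zero_ne_one hD
    set A : Matrix.SpecialLinearGroup ι F := ⟨diagonal D, hD⟩ with hA
    have hAd : Matrix.SpecialLinearGroup.toGL A = dg (fun i => Units.mk0 (D i) (hne i)) := by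
      apply Units.ext; rfl
    obtain ⟨B, hB⟩ := QuotientGroup.mk'_surjective _ (β (pr A))
    have key : ∀ (i j : ι) (hij : i ≠ j), cL (Matrix.SpecialLinearGroup.toGL (A⁻¹ * B))
        (pr (tv hij 1)) = pr (tv hij 1) := by
      intro i j hij
      have hq : MulAut.conj (pr A) (pr (tv hij 1)) = MulAut.conj (pr B) (pr (tv hij 1)) := by
        have h0 : MulAut.conj (pr A) (pr (tv hij 1)) = β (MulAut.conj (pr A) (pr (tv hij 1))) := by
          rw [← cL_coe A, hAd, cL_pr, dg_conj, h i j hij]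
        rw [h0, MulAut.conj_apply, map_mul, map_mul, map_inv, h i j hij, ← hB]
        rfl
      rw [cL_coe, map_mul, map_inv, map_mul, MulAut.mul_apply, ← hq, map_inv, MulAut.inv_apply_self]
    obtain ⟨u, hu⟩ := fix_scalar key
    have h1 : cL (Matrix.SpecialLinearGroup.toGL (A⁻¹ * B)) = 1 := by rw [hu, cL_scalar]
    change β (pr A) = pr A
    rw [← hB]
    symm
    change pr A = pr B
    rw [pr_eq_iff]
    have h2 : Matrix.SpecialLinearGroup.toGL B = Matrix.SpecialLinearGroup.toGL A *
      GeneralLinearGroup.scalar ι u := by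
      rw [← hu, ← map_mul, mul_inv_cancel_left]
    have hdet : u ^ Fintype.card ι = 1 := by
      have := congrArg GeneralLinearGroup.det h2
      rw [map_mul, det_coe_SL, det_coe_SL, one_mul, GeneralLinearGroup.det_scalar] at this
      exact this.symm
    refine ⟨((u⁻¹ : Fˣ) : F), ?_, ?_⟩
    · rw [← Units.val_pow_eq_pow_val, inv_pow, hdet]; simp
    · have h3 : B.val = A.val * (u : F) • 1 := by
        have := congrArg Units.val h2
        rw [Units.val_mul, GeneralLinearGroup.coe_scalar] at this
        rw [Matrix.smul_one_eq_diagonal]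
        exact this
      rw [h3, mul_smul_comm, mul_one, smul_smul]; simp
  have hall : ∀ A : Matrix.SpecialLinearGroup ι F, A ∈ K := by
    intro A
    have : ∃ h : det A.val = 1, (⟨A.val, h⟩ : Matrix.SpecialLinearGroup ι F) ∈ K := by
      refine diagonal_transvection_induction
        (fun N => ∃ h : det N = 1, (⟨N, h⟩ : Matrix.SpecialLinearGroup ι F) ∈ K) A.val ?_ ?_ ?_
      · intro D hD
        exact ⟨hD.trans A.2, hdiag D _⟩
      · intro t
        exact ⟨t.det, h t.i t.j t.hij t.c⟩
      · rintro M N ⟨h1, h2⟩ ⟨h3, h4⟩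
        exact ⟨by rw [det_mul, h1, h3, one_mul], K.mul_mem h2 h4⟩
    exact this.2
  apply MulEquiv.ext
  intro x
  obtain ⟨A, rfl⟩ := QuotientGroup.mk'_surjective _ x
  exact hall A

end gen
end AbSup


namespace AbSup
open Matrix

section std
variable {F : Type*} [Field F] {ι : Type*} [Fintype ι] [DecidableEq ι]

lemma tv_add {i j : ι} (hij : i ≠ j) (a b : F) : tv hij (a + b) = tv hij a * tv hij b := by
  apply Subtype.ext
  change _ = (tv hij a).val * (tv hij b).val
  rw [tv_val, tv_val, tv_val, mul_add, add_mul, add_mul, Matrix.single_mul_single_of_ne _ _ _ _ hij.symm,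
    Matrix.single_add]
  simp [add_assoc]

lemma tv_comm {i j k : ι} (hij : i ≠ j) (hjk : j ≠ k) (hik : i ≠ k) (a b : F) :
    tv hij a * tv hjk b = tv hik (a * b) * tv hjk b * tv hij a := by
  apply Subtype.ext
  change (tv hij a).val * (tv hjk b).val = (tv hik (a * b)).val * (tv hjk b).val * (tv hij a).val
  simp only [tv_val, mul_add, add_mul, one_mul, mul_one]
  simp only [Matrix.single_mul_single_of_ne _ _ _ _ hij.symm,
    Matrix.single_mul_single_of_ne _ _ _ _ hjk.symm,
    Matrix.single_mul_single_of_ne _ _ _ _ hik.symm, Matrix.single_mul_single_same, zero_mul]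
  abel

lemma conj_sq (W T : Matrix.SpecialLinearGroup ι F) (hT : (T.val - 1) * (T.val - 1) = 0) :
    ((W * T * W⁻¹).val - 1) * ((W * T * W⁻¹).val - 1) = 0 := by
  have h1 : W.val * (W⁻¹).val = 1 := congrArg Subtype.val (mul_inv_cancel W)
  have h2 : (W⁻¹).val * W.val = 1 := congrArg Subtype.val (inv_mul_cancel W)
  have h3 : (W * T * W⁻¹).val - 1 = W.val * (T.val - 1) * (W⁻¹).val := by
    rw [mul_sub, sub_mul, mul_one, h1]; rfl
  rw [h3]
  calc _ = W.val * (T.val - 1) * ((W⁻¹).val * W.val) * (T.val - 1) * (W⁻¹).val := by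
        simp only [mul_assoc]
    _ = W.val * ((T.val - 1) * (T.val - 1)) * (W⁻¹).val := by rw [h2, mul_one, mul_assoc W.val]
    _ = 0 := by rw [hT]; simp

lemma ringAut_of {φ : F → F} [Finite F] (hadd : ∀ a b, φ (a + b) = φ a + φ b) (h1 : φ 1 = 1)
    (hmul : ∀ a b, φ (a * b) = φ a * φ b) : ∃ σ : RingAut F, ∀ a, σ a = φ a := by
  let r : F →+* F :=
    { toFun := φ, map_one' := h1, map_mul' := hmul, map_add' := hadd,
      map_zero' := by have := hadd 0 0; simpa using this }
  exact ⟨RingEquiv.ofBijective r (Finite.injective_iff_bijective.1 r.injective), fun a => rfl⟩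

lemma fun_std (f : ι → ι → F → F) (o j0 : ι) (hj0 : o ≠ j0)
    (hthird : ∀ i j : ι, ∃ k, k ≠ i ∧ k ≠ j)
    (hm : ∀ i j k, i ≠ j → j ≠ k → i ≠ k → ∀ a b, f i k (a * b) = f i j a * f j k b)
    (h1 : ∀ j, o ≠ j → f o j 1 = 1) :
    (∀ i j, i ≠ j → ∀ a, f i j a = f o j0 a) ∧ ∀ a b, f o j0 (a * b) = f o j0 a * f o j0 b := by
  have A1 : ∀ j k, o ≠ j → o ≠ k → j ≠ k → ∀ b, f j k b = f o k b := by
    intro j k hj hk hjk b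
    have := hm o j k hj hjk hk 1 b
    rw [h1 j hj, one_mul, one_mul] at this
    exact this.symm
  have A2 : ∀ j k, o ≠ j → o ≠ k → j ≠ k → ∀ b, f o k b = f o j b := by
    intro j k hj hk hjk b
    have := hm o j k hj hjk hk b 1
    rw [A1 j k hj hk hjk, h1 k hk, mul_one, mul_one] at this
    exact this
  have A3 : ∀ j, o ≠ j → ∀ b, f o j b = f o j0 b := by
    intro j hj b
    by_cases h : j = j0
    · rw [h]
    · exact A2 j0 j hj0 hj (Ne.symm h) b
  have A4 : ∀ j, o ≠ j → ∀ b, f j o b = f o j0 b := by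
    intro j hj b
    obtain ⟨k, hk1, hk2⟩ := hthird o j
    have := hm j o k hj.symm hk1.symm hk2.symm b 1
    rw [h1 k hk1.symm, mul_one, mul_one, A1 j k hj hk1.symm hk2.symm, A3 k hk1.symm] at this
    exact this.symm
  have A5 : ∀ i j, i ≠ j → ∀ a, f i j a = f o j0 a := by
    intro i j hij a
    by_cases hi : o = i
    · subst hi; exact A3 j hij a
    · by_cases hj : o = j
      · subst hj; exact A4 i hi a
      · rw [A1 i j hi hj hij, A3 j hj]
  refine ⟨A5, fun a b => ?_⟩
  obtain ⟨k, hk1, hk2⟩ := hthird o j0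
  have := hm o k j0 hk1.symm hk2 hj0 a b
  rw [A5 o k hk1.symm, A5 k j0 hk2] at this
  exact this

lemma std_zero {β : MulAut (PS F ι)} {f : ι → ι → F → F}
    (h : ∀ (i j : ι) (hij : i ≠ j) (a : F), β (pr (tv hij a)) = pr (tv hij (f i j a)))
    (i j : ι) (hij : i ≠ j) : (∀ a b, f i j (a + b) = f i j a + f i j b) ∧
      (∀ a b, f i j a = f i j b → a = b) ∧ ∀ a, a ≠ 0 → f i j a ≠ 0 := by
  have hadd : ∀ a b, f i j (a + b) = f i j a + f i j b := by
    intro a b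
    apply tv_inj hij
    rw [← h, tv_add, tv_add, map_mul, map_mul, map_mul, h, h]
  have hinj : ∀ a b, f i j a = f i j b → a = b := by
    intro a b hab
    apply tv_inj hij
    apply β.injective
    rw [h, h, hab]
  refine ⟨hadd, hinj, fun a ha h0 => ha (hinj a 0 ?_)⟩
  have := hadd 0 0
  rw [add_zero] at this
  rw [h0]; symm; simpa using this

lemma std_dg {β : MulAut (PS F ι)} {f : ι → ι → F → F}
    (h : ∀ (i j : ι) (hij : i ≠ j) (a : F), β (pr (tv hij a)) = pr (tv hij (f i j a)))
    (u : ι → Fˣ) : ∀ (i j : ι) (hij : i ≠ j) (a : F), (cL (dg u) * β) (pr (tv hij a)) =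
      pr (tv hij (u i * f i j a * ((u j)⁻¹ : Fˣ))) := by
  intro i j hij a
  rw [MulAut.mul_apply, h, cL_pr, dg_conj]

lemma std_mul {β : MulAut (PS F ι)} {f : ι → ι → F → F}
    (h : ∀ (i j : ι) (hij : i ≠ j) (a : F), β (pr (tv hij a)) = pr (tv hij (f i j a))) :
    ∀ i j k, i ≠ j → j ≠ k → i ≠ k → ∀ a b, f i k (a * b) = f i j a * f j k b := by
  intro i j k hij hjk hik a b
  apply tv_inj hik
  rw [← h]
  have e1 : ∀ a b : F, tv hik (a * b) = tv hij a * tv hjk b * (tv hjk b * tv hij a)⁻¹ := by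
    intro a b; rw [tv_comm hij hjk hik]; group
  rw [e1, e1]
  simp only [map_mul, map_inv, h]

lemma std_three [Finite F] (o j0 : ι) (hj0 : o ≠ j0) (hthird : ∀ i j : ι, ∃ k, k ≠ i ∧ k ≠ j)
    {β : MulAut (PS F ι)} {f : ι → ι → F → F}
    (h : ∀ (i j : ι) (hij : i ≠ j) (a : F), β (pr (tv hij a)) = pr (tv hij (f i j a))) :
    ∃ (g : GL ι F) (σ : RingAut F), ∀ (i j : ι) (hij : i ≠ j) (a : F),
      (cL g * β) (pr (tv hij a)) = pr (tv hij (σ a)) := by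
  let u : ι → Fˣ := fun j => if hj : o ≠ j then Units.mk0 (f o j 1)
    ((std_zero h o j hj).2.2 1 one_ne_zero) else 1
  have h' := std_dg h u
  have hu : ∀ j, o ≠ j → (u o : F) * f o j 1 * ((u j)⁻¹ : Fˣ) = 1 := by
    intro j hj
    have h0 := (std_zero h o j hj).2.2 1 one_ne_zero
    simp [u, hj, h0]
  obtain ⟨h1, h2⟩ := fun_std (fun i j a => (u i : F) * f i j a * ((u j)⁻¹ : Fˣ)) o j0 hj0 hthird
    (std_mul h') hu
  obtain ⟨σ, hσ⟩ := ringAut_of (φ := fun a => (u o : F) * f o j0 a * ((u j0)⁻¹ : Fˣ))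
    (std_zero h' o j0 hj0).1 (hu j0 hj0) h2
  refine ⟨dg u, σ, fun i j hij a => ?_⟩
  rw [h', hσ]
  congr 2
  exact h1 i j hij a

end std

section two
variable {F : Type*} [Field F]

lemma fun_two (f g : F → F) (fadd : ∀ a b, f (a + b) = f a + f b)
    (gadd : ∀ a b, g (a + b) = g a + g b) (f1 : f 1 = 1) (f0 : ∀ a, a ≠ 0 → f a ≠ 0)
    (hr : ∀ a x, a ≠ 0 → g (-(x / a ^ 2)) = - (f x / f a ^ 2)) [Finite F] :
    (∀ a, g a = f a) ∧ ∀ a b, f (a * b) = f a * f b := by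
  have gneg : ∀ a, g (-a) = - g a := by
    intro a
    have h0 : g 0 = 0 := by simpa using gadd 0 0
    have := gadd a (-a)
    rw [add_neg_cancel, h0] at this
    linear_combination -this
  have hgf : ∀ a, g a = f a := by
    intro a
    have := hr 1 a one_ne_zero
    rw [gneg, f1] at this
    simpa using this
  have hsq : ∀ a y, f (a ^ 2 * y) = f a ^ 2 * f y := by
    intro a y
    by_cases ha : a = 0
    · have h0 : f 0 = 0 := by simpa using fadd 0 0
      subst ha; simp [h0]
    · have := hr a (a ^ 2 * y) ha
      rw [gneg, hgf, mul_div_cancel_left₀ _ (pow_ne_zero 2 ha)] at this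
      have h1 := f0 a ha
      field_simp at this
      linear_combination this
  have hsq1 : ∀ a, f (a ^ 2) = f a ^ 2 := by
    intro a; have := hsq a 1; rwa [mul_one, f1, mul_one] at this
  refine ⟨hgf, fun x y => ?_⟩
  by_cases h2 : (2 : F) = 0
  · haveI : Fintype F := Fintype.ofFinite F
    have hc : ringChar F = 2 := by
      have : CharP F 2 := CharTwo.of_one_ne_zero_of_two_eq_zero one_ne_zero h2
      exact ringChar.eq F 2
    obtain ⟨z, hz⟩ := FiniteField.isSquare_of_char_two hc x
    rw [hz, ← pow_two, hsq, hsq1]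
  · have fsub : ∀ a b, f (a - b) = f a - f b := by
      intro a b
      have := fadd (a - b) b
      rw [sub_add_cancel] at this
      linear_combination -this
    have e : x = ((x + 1) / 2) ^ 2 - ((x - 1) / 2) ^ 2 := by field_simp; ring
    rw [e, sub_mul, fsub, fsub, hsq, hsq, hsq1, hsq1, sub_mul]

lemma std_two [Finite F] {β : MulAut (PS F (Fin 2))} {f : Fin 2 → Fin 2 → F → F}
    (h : ∀ (i j : Fin 2) (hij : i ≠ j) (a : F), β (pr (tv hij a)) = pr (tv hij (f i j a))) :
    ∃ (g : GL (Fin 2) F) (σ : RingAut F), ∀ (i j : Fin 2) (hij : i ≠ j) (a : F),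
      (cL g * β) (pr (tv hij a)) = pr (tv hij (σ a)) := by
  have h01 : (0 : Fin 2) ≠ 1 := by decide
  have h10 : (1 : Fin 2) ≠ 0 := by decide
  have main : ∀ {β : MulAut (PS F (Fin 2))} {f : Fin 2 → Fin 2 → F → F}
    (_ : ∀ (i j : Fin 2) (hij : i ≠ j) (a : F), β (pr (tv hij a)) = pr (tv hij (f i j a))),
    ∀ a x, a ≠ 0 → f 1 0 (-(x / a ^ 2)) = - (f 0 1 x / f 0 1 a ^ 2) := by
    intro β f h
    have rel : ∀ a x : F, a ≠ 0 → tv h01 a * tv h10 (-a⁻¹) * tv h01 a * tv h01 x *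
        (tv h01 a * tv h10 (-a⁻¹) * tv h01 a)⁻¹ = tv h10 (-(x / a ^ 2)) := by
      intro a x ha
      rw [mul_inv_eq_iff_eq_mul]
      apply Subtype.ext
      simp only [Matrix.SpecialLinearGroup.coe_mul, tv_val]
      ext i j
      fin_cases i <;> fin_cases j <;> simp [Matrix.mul_apply, Matrix.single, ha] <;>
        (try field_simp) <;> ring
    have key : ∀ a x : F, a ≠ 0 → x ≠ 0 → f 1 0 (-a⁻¹) * f 0 1 a = -1 ∧
        f 0 1 x * f 1 0 (-a⁻¹) = f 1 0 (-(x / a ^ 2)) * f 0 1 a := by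
      intro a x ha hx
      have e := congrArg β (congrArg pr (rel a x ha))
      simp only [map_mul, map_inv, h] at e
      simp only [← map_mul, ← map_inv] at e
      set X := f 0 1 x with hX
      set A := f 0 1 a
      set B := f 1 0 (-a⁻¹)
      set Y := f 1 0 (-(x / a ^ 2))
      have hX0 : X ≠ 0 := (std_zero h 0 1 h01).2.2 x hx
      have e2 := pr_unip ?_ (tv_sq h10 Y) e
      · rw [mul_inv_eq_iff_eq_mul] at e2
        have e3 := congrArg Subtype.val e2
        simp only [Matrix.SpecialLinearGroup.coe_mul, tv_val] at e3
        have e01 := congrFun (congrFun e3 0) 1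
        have e11 := congrFun (congrFun e3 1) 1
        simp [Matrix.mul_apply, Matrix.single] at e01 e11
        have k1 : 1 + A * B = 0 := e01.resolve_right hX0
        refine ⟨by linear_combination k1, ?_⟩
        linear_combination e11 + Y * A * k1
      · exact conj_sq _ _ (tv_sq h01 X)
    intro a x ha
    have hA0 : f 0 1 a ≠ 0 := (std_zero h 0 1 h01).2.2 a ha
    by_cases hx : x = 0
    · have z1 : f 0 1 0 = 0 := by simpa using (std_zero h 0 1 h01).1 0 0
      have z2 : f 1 0 0 = 0 := by simpa using (std_zero h 1 0 h10).1 0 0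
      subst hx; simp [z1, z2]
    · obtain ⟨k1, k2⟩ := key a x ha hx
      field_simp
      linear_combination f 0 1 x * k1 - f 0 1 a * k2
  have f00 : f 0 1 1 ≠ 0 := (std_zero h 0 1 h01).2.2 1 one_ne_zero
  let u : Fin 2 → Fˣ := fun j => if j = 1 then Units.mk0 (f 0 1 1) f00 else 1
  have h' := std_dg h u
  have hu : (u 0 : F) * f 0 1 1 * ((u 1)⁻¹ : Fˣ) = 1 := by
    simp [u, f00]
  obtain ⟨h1, h2⟩ := fun_two (fun a => (u 0 : F) * f 0 1 a * ((u 1)⁻¹ : Fˣ))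
    (fun a => (u 1 : F) * f 1 0 a * ((u 0)⁻¹ : Fˣ)) (std_zero h' 0 1 h01).1 (std_zero h' 1 0 h10).1 hu
    (std_zero h' 0 1 h01).2.2 (main h')
  obtain ⟨σ, hσ⟩ := ringAut_of (φ := fun a => (u 0 : F) * f 0 1 a * ((u 1)⁻¹ : Fˣ))
    (std_zero h' 0 1 h01).1 hu h2
  refine ⟨dg u, σ, fun i j hij a => ?_⟩
  rw [h', hσ]
  congr 2
  fin_cases i <;> fin_cases j
  · exact absurd rfl hij
  · rfl
  · exact h1 a
  · exact absurd rfl hij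

end two
end AbSup


namespace AbSup
open Matrix

section rd
variable {F : Type*} [Field F] {ι : Type*} [Fintype ι] [DecidableEq ι]

lemma vv_mul (u v w x : ι → F) : vecMulVec u v * vecMulVec w x = (v ⬝ᵥ w) • vecMulVec u x := by
  rw [vecMulVec_mul_vecMulVec, vecMulVec_smul]

/-- images of the root elements are given by rank one matrices -/
structure RD (α : MulAut (PS F ι)) (u v : ι → ι → ι → F) (f : ι → ι → F → F) : Prop where
  rt : ∀ (i j : ι) (hij : i ≠ j) (a : F), ∃ T : Matrix.SpecialLinearGroup ι F,
    T.val = 1 + f i j a • vecMulVec (u i j) (v i j) ∧ α (pr (tv hij a)) = pr T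
  orth : ∀ i j, i ≠ j → v i j ⬝ᵥ u i j = 0
  one : ∀ i j, f i j 1 = 1

variable {α : MulAut (PS F ι)} {u v : ι → ι → ι → F} {f : ι → ι → F → F}

lemma RD.ex (h : RD α u v f) (i j : ι) (hij : i ≠ j) : ∃ T : Matrix.SpecialLinearGroup ι F,
    T.val = 1 + vecMulVec (u i j) (v i j) ∧ α (pr (tv hij 1)) = pr T ∧
      (T.val - 1) * (T.val - 1) = 0 := by
  obtain ⟨T, h1, h2⟩ := h.rt i j hij 1
  rw [h.one, one_smul] at h1
  refine ⟨T, h1, h2, ?_⟩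
  rw [h1, add_sub_cancel_left, vv_mul, h.orth i j hij, zero_smul]

lemma tv_zero {i j : ι} (hij : i ≠ j) : tv hij (0 : F) = 1 := by
  apply Subtype.ext
  rw [tv_val]; simp

lemma RD.ne (h : RD α u v f) (i j : ι) (hij : i ≠ j) : u i j ≠ 0 ∧ v i j ≠ 0 := by
  obtain ⟨T, h1, h2, -⟩ := h.ex i j hij
  have key : vecMulVec (u i j) (v i j) ≠ 0 := by
    intro h0
    rw [h0, add_zero] at h1
    have : T = 1 := Subtype.ext h1
    rw [this, map_one, MulEquiv.map_eq_one_iff] at h2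
    have h3 : pr (tv hij (1 : F)) = pr (tv hij 0) := by rw [h2, tv_zero, map_one]
    exact one_ne_zero (tv_inj hij h3)
  constructor <;> rintro h0 <;> apply key <;> rw [h0] <;> simp

lemma RD.comm (h : RD α u v f) {i j k l : ι} (hij : i ≠ j) (hkl : k ≠ l)
    (hc : tv hij (1 : F) * tv hkl 1 = tv hkl 1 * tv hij 1) :
    v i j ⬝ᵥ u k l = 0 ∧ v k l ⬝ᵥ u i j = 0 := by
  haveI : Nonempty ι := ⟨i⟩
  obtain ⟨S, s1, s2, s3⟩ := h.ex i j hij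
  obtain ⟨T, t1, t2, t3⟩ := h.ex k l hkl
  have e : pr (S * T * S⁻¹) = pr T := by
    rw [map_mul, map_mul, map_inv, ← s2, ← t2, ← map_mul, ← map_mul, hc, map_mul, map_mul]
    group
  have e2 := pr_unip (conj_sq _ _ t3) t3 e
  rw [mul_inv_eq_iff_eq_mul] at e2
  have e3 : S.val * T.val = T.val * S.val := congrArg Subtype.val e2
  rw [s1, t1] at e3
  simp only [mul_add, add_mul, vv_mul, mul_one, one_mul] at e3
  have e4 : (v i j ⬝ᵥ u k l) • vecMulVec (u i j) (v k l) =
      (v k l ⬝ᵥ u i j) • vecMulVec (u k l) (v i j) := by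
    rw [← sub_eq_zero] at e3 ⊢; rw [← e3]; module
  have e5 := congrArg (fun M => M *ᵥ (u k l)) e4
  simp only [smul_mulVec, vecMulVec_mulVec, h.orth k l hkl] at e5
  obtain ⟨a1, a2⟩ := h.ne i j hij
  obtain ⟨b1, b2⟩ := h.ne k l hkl
  have e6 : v k l ⬝ᵥ u i j = 0 ∨ v i j ⬝ᵥ u k l = 0 := by
    simpa [b1] using e5.symm
  rcases e6 with e6 | e6
  · rw [e6, zero_smul, smul_eq_zero] at e4
    exact ⟨e4.resolve_right (vecMulVec_ne_zero a1 b2), e6⟩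
  · rw [e6, zero_smul, eq_comm, smul_eq_zero] at e4
    exact ⟨e6, e4.resolve_right (vecMulVec_ne_zero b1 a2)⟩

lemma tv_commute {i j k l : ι} (hij : i ≠ j) (hkl : k ≠ l) (hjk : j ≠ k) (hil : i ≠ l) (a b : F) :
    tv hij a * tv hkl b = tv hkl b * tv hij a := by
  apply Subtype.ext
  change (tv hij a).val * (tv hkl b).val = (tv hkl b).val * (tv hij a).val
  simp only [tv_val, mul_add, add_mul, one_mul, mul_one]
  rw [Matrix.single_mul_single_of_ne _ _ _ _ hjk, Matrix.single_mul_single_of_ne _ _ _ _ hil.symm]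
  abel

lemma RD.comm' (h : RD α u v f) {i j k l : ι} (hij : i ≠ j) (hkl : k ≠ l) (hjk : j ≠ k)
    (hil : i ≠ l) : v i j ⬝ᵥ u k l = 0 ∧ v k l ⬝ᵥ u i j = 0 :=
  h.comm hij hkl (tv_commute hij hkl hjk hil 1 1)

lemma RD.tri (h : RD α u v f) {i j k : ι} (hij : i ≠ j) (hjk : j ≠ k) (hik : i ≠ k) :
    (v i j ⬝ᵥ u j k) • vecMulVec (u i j) (v j k) =
      vecMulVec (u i k) (v i k) + (v j k ⬝ᵥ u i j) • vecMulVec (u j k) (v i j) := by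
  haveI : Nonempty ι := ⟨i⟩
  obtain ⟨R, r1, r2, r3⟩ := h.ex i j hij
  obtain ⟨S, s1, s2, s3⟩ := h.ex j k hjk
  obtain ⟨T, t1, t2, t3⟩ := h.ex i k hik
  have c1 := h.comm' hik hij hik.symm hij
  have c2 := h.comm' hik hjk hjk.symm hik
  have e : pr (R * S * R⁻¹) = pr (T * S) := by
    have := tv_comm hij hjk hik (1 : F) 1
    rw [mul_one] at this
    have := congrArg α (congrArg pr this)
    simp only [map_mul, r2, s2, t2] at this
    rw [map_mul, map_mul, map_inv, this, map_mul, mul_inv_cancel_right]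
  have hsq : ((T * S).val - 1) * ((T * S).val - 1) = 0 := by
    have : (T * S).val - 1 = vecMulVec (u i k) (v i k) + vecMulVec (u j k) (v j k) := by
      change T.val * S.val - 1 = _
      rw [t1, s1]
      simp only [mul_add, add_mul, vv_mul, mul_one, one_mul, c2.1, zero_smul]
      abel
    rw [this]
    simp only [mul_add, add_mul, vv_mul, c2.1, c2.2, h.orth i k hik, h.orth j k hjk, zero_smul,
      add_zero]
  have e2 := pr_unip (conj_sq _ _ s3) hsq e
  rw [mul_inv_eq_iff_eq_mul] at e2
  have e3 : R.val * S.val = T.val * S.val * R.val := congrArg Subtype.val e2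
  rw [r1, s1, t1] at e3
  simp only [mul_add, add_mul, vv_mul, mul_one, one_mul, c2.1, c1.1, zero_smul, add_zero,
    smul_mul_assoc] at e3
  rw [← sub_eq_zero] at e3 ⊢; rw [← e3]; module

lemma RD.dich (h : RD α u v f) {i j k : ι} (hij : i ≠ j) (hjk : j ≠ k) (hik : i ≠ k) :
    (v i j ⬝ᵥ u j k ≠ 0 ∧ v j k ⬝ᵥ u i j = 0) ∨ (v i j ⬝ᵥ u j k = 0 ∧ v j k ⬝ᵥ u i j ≠ 0) := by
  have e := h.tri hij hjk hik
  have c2 := h.comm' hik hjk hjk.symm hik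
  have e5 := congrArg (fun M => M *ᵥ (u j k)) e
  simp only [smul_mulVec, vecMulVec_mulVec, h.orth j k hjk, add_mulVec, c2.1] at e5
  obtain ⟨a1, a2⟩ := h.ne i k hik
  obtain ⟨b1, b2⟩ := h.ne j k hjk
  have e6 : v j k ⬝ᵥ u i j = 0 ∨ v i j ⬝ᵥ u j k = 0 := by
    simpa [b1] using e5.symm
  by_cases h1 : v i j ⬝ᵥ u j k = 0
  · refine Or.inr ⟨h1, fun h2 => ?_⟩
    rw [h1, h2, zero_smul, zero_smul, add_zero] at e
    exact vecMulVec_ne_zero a1 a2 e.symm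
  · exact Or.inl ⟨h1, e6.resolve_right h1⟩

lemma vv_par {c : F} {u v u' v' : ι → F} (hc : c ≠ 0) (hu : u' ≠ 0) (hv : v' ≠ 0)
    (h : c • vecMulVec u v = vecMulVec u' v') :
    ∃ s t : F, s ≠ 0 ∧ t ≠ 0 ∧ u' = s • u ∧ v' = t • v := by
  obtain ⟨i, hi⟩ := Function.ne_iff.1 hu
  obtain ⟨j, hj⟩ := Function.ne_iff.1 hv
  simp only [Pi.zero_apply] at hi hj
  have e : ∀ a b, c * (u a * v b) = u' a * v' b := fun a b => by
    have := congrFun (congrFun h a) b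
    simpa [vecMulVec_apply] using this
  have h0 : c * (u i * v j) ≠ 0 := by rw [e]; exact mul_ne_zero hi hj
  have hui : u i ≠ 0 := fun h1 => h0 (by rw [h1]; ring)
  have hvj : v j ≠ 0 := fun h1 => h0 (by rw [h1]; ring)
  refine ⟨c * v j / v' j, c * u i / u' i, by positivity, by positivity, ?_, ?_⟩
  · ext a; simp only [Pi.smul_apply, smul_eq_mul]; field_simp; linear_combination - e a j
  · ext b; simp only [Pi.smul_apply, smul_eq_mul]; field_simp; linear_combination - e i b

lemma RD.S (h : RD α u v f) {i j k : ι} (hij : i ≠ j) (hjk : j ≠ k) (hik : i ≠ k)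
    (hp : v i j ⬝ᵥ u j k ≠ 0) : ∃ s t : F, s ≠ 0 ∧ t ≠ 0 ∧ u i k = s • u i j ∧ v i k = t • v j k := by
  have e := h.tri hij hjk hik
  have hr : v j k ⬝ᵥ u i j = 0 := by
    rcases h.dich hij hjk hik with h1 | h1
    · exact h1.2
    · exact absurd h1.1 hp
  rw [hr, zero_smul, add_zero] at e
  exact vv_par hp (h.ne i k hik).1 (h.ne i k hik).2 e

lemma RD.C (h : RD α u v f) {i j k : ι} (hij : i ≠ j) (hjk : j ≠ k) (hik : i ≠ k)
    (hp : v i j ⬝ᵥ u j k = 0) : ∃ s t : F, s ≠ 0 ∧ t ≠ 0 ∧ u i k = s • u j k ∧ v i k = t • v i j := by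
  have e := h.tri hij hjk hik
  have hr : v j k ⬝ᵥ u i j ≠ 0 := by
    rcases h.dich hij hjk hik with h1 | h1
    · exact absurd hp h1.1
    · exact h1.2
  rw [hp, zero_smul] at e
  have e' : (-(v j k ⬝ᵥ u i j)) • vecMulVec (u j k) (v i j) = vecMulVec (u i k) (v i k) := by
    rw [← sub_eq_zero] at e ⊢; rw [← e]; module
  exact vv_par (neg_ne_zero.2 hr) (h.ne i k hik).1 (h.ne i k hik).2 e'

lemma RD.S1 (h : RD α u v f) {i j k : ι} (hij : i ≠ j) (hjk : j ≠ k) (hik : i ≠ k)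
    (hp : v i j ⬝ᵥ u j k ≠ 0) : v j i ⬝ᵥ u i k ≠ 0 := by
  intro hc
  obtain ⟨s, t, hs, ht, h1, h2⟩ := h.S hij hjk hik hp
  obtain ⟨s', t', hs', ht', h1', h2'⟩ := h.C hij.symm hik hjk hc
  apply hp
  rw [h1', h1, dotProduct_smul, dotProduct_smul, h.orth i j hij]; simp

lemma RD.S2 (h : RD α u v f) {i j k : ι} (hij : i ≠ j) (hjk : j ≠ k) (hik : i ≠ k)
    (hp : v i j ⬝ᵥ u j k ≠ 0) : v i k ⬝ᵥ u k j ≠ 0 := by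
  intro hc
  obtain ⟨s, t, hs, ht, h1, h2⟩ := h.S hij hjk hik hp
  obtain ⟨s', t', hs', ht', h1', h2'⟩ := h.C hik hjk.symm hij hc
  apply hp
  rw [h2', h2, smul_dotProduct, smul_dotProduct, h.orth j k hjk]; simp

lemma RD.S3 (h : RD α u v f) {i j k l : ι} (hij : i ≠ j) (hjk : j ≠ k) (hik : i ≠ k)
    (hil : i ≠ l) (hjl : j ≠ l)
    (hp : v i j ⬝ᵥ u j k ≠ 0) : v i j ⬝ᵥ u j l ≠ 0 := by
  intro hc
  obtain ⟨s', t', hs', ht', h1', h2'⟩ := h.C hij hjl hil hc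
  have := (h.comm' hil hjk hjl.symm hik).1
  rw [h2', smul_dotProduct, smul_eq_mul, mul_eq_zero] at this
  exact hp (this.resolve_left ht')

lemma RD.all (h : RD α u v f) {i j k : ι} (hij : i ≠ j) (hjk : j ≠ k) (hik : i ≠ k)
    (hp : v i j ⬝ᵥ u j k ≠ 0) {x y z : ι} (hxy : x ≠ y) (hyz : y ≠ z) (hxz : x ≠ z) :
    v x y ⬝ᵥ u y z ≠ 0 := by
  let R : ι → ι → ι → Prop := fun i j k => i ≠ j ∧ j ≠ k ∧ i ≠ k ∧ v i j ⬝ᵥ u j k ≠ 0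
  have p1 : ∀ {i j k}, R i j k → R j i k := fun ⟨a, b, c, d⟩ => ⟨a.symm, c, b, h.S1 a b c d⟩
  have p2 : ∀ {i j k}, R i j k → R i k j := fun ⟨a, b, c, d⟩ => ⟨c, b.symm, a, h.S2 a b c d⟩
  have p3 : ∀ {i j k} l, R i j k → i ≠ l → j ≠ l → R i j l :=
    fun l ⟨a, b, c, d⟩ e g => ⟨a, g, e, h.S3 a b c e g d⟩
  have r0 : R i j k := ⟨hij, hjk, hik, hp⟩
  have r1 : ∃ b c, R x b c := by
    by_cases h1 : i = x
    · subst h1; exact ⟨_, _, r0⟩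
    by_cases h2 : j = x
    · subst h2; exact ⟨_, _, p1 r0⟩
    exact ⟨_, _, p1 (p2 (p3 x r0 h1 h2))⟩
  obtain ⟨b, c, r1⟩ := r1
  have r2 : ∃ c, R x y c := by
    by_cases h1 : b = y
    · subst h1; exact ⟨_, r1⟩
    exact ⟨_, p2 (p3 y r1 hxy h1)⟩
  obtain ⟨c, r2⟩ := r2
  exact (p3 z r2 hxz hyz).2.2.2

end rd
end AbSup


namespace AbSup
open Matrix

section st
variable {F : Type*} [Field F] {ι : Type*} [Fintype ι] [DecidableEq ι]

/-- standard automorphisms -/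
def Good (α : MulAut (PS F ι)) : Prop := ∃ (g : GL ι F) (τ : TT F), α = cL g * tL τ

lemma Good.of_cL {α : MulAut (PS F ι)} (g : GL ι F) (h : Good (cL g * α)) : Good α := by
  obtain ⟨g', τ, h⟩ := h
  refine ⟨g⁻¹ * g', τ, ?_⟩
  rw [map_mul, mul_assoc, ← h, map_inv, inv_mul_cancel_left]

lemma Good.of_tL {α : MulAut (PS F ι)} (τ : TT F) (h : Good (tL τ * α)) : Good α := by
  obtain ⟨g', τ', h⟩ := h
  refine ⟨theta τ⁻¹ g', τ⁻¹ * τ', ?_⟩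
  rw [map_mul, ← mul_assoc, ← tL_cL, mul_assoc, ← h, map_inv, inv_mul_cancel_left]

lemma tL_tv (σ : RingAut F) {i j : ι} (hij : i ≠ j) (a : F) :
    (tL (σ, 1) : MulAut (PS F ι)) (pr (tv hij a)) = pr (tv hij (σ a)) := by
  change pr (resSL (tD (σ, 1)) (tv hij a)) = _
  congr 1
  apply Matrix.SpecialLinearGroup.toGL_injective
  rw [toGL_resSL, tD_val, theta_one]
  ext k l
  rw [fieldAut_apply]
  change σ ((tv hij a).val k l) = (tv hij (σ a)).val k l
  rw [tv_val, tv_val]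
  simp only [Matrix.add_apply, map_add, Matrix.single_apply, Matrix.one_apply]
  split_ifs <;> simp

lemma tL_flip {T : Matrix.SpecialLinearGroup ι F} {c : F} {u v : ι → F} (h0 : v ⬝ᵥ u = 0)
    (hT : T.val = 1 + c • vecMulVec u v) : ∃ T' : Matrix.SpecialLinearGroup ι F,
    T'.val = 1 + c • vecMulVec v (-u) ∧ (tL (1, -1) : MulAut (PS F ι)) (pr T) = pr T' := by
  refine ⟨resSL (tD (1, -1)) T, ?_, rfl⟩
  have h1 : T.val * (1 - c • vecMulVec u v) = 1 := by
    rw [hT]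
    simp only [mul_sub, add_mul, vv_mul, mul_one, one_mul, smul_mul_assoc, mul_smul_comm, h0,
      zero_smul, smul_zero]
    abel
  have h2 : (T⁻¹).val = 1 - c • vecMulVec u v := by
    have h3 : (T⁻¹).val * T.val = 1 := congrArg Subtype.val (inv_mul_cancel T)
    calc (T⁻¹).val = (T⁻¹).val * (T.val * (1 - c • vecMulVec u v)) := by rw [h1, mul_one]
      _ = _ := by rw [← mul_assoc, h3, one_mul]
  have h4 : (resSL (tD (1, -1)) T).val = ((T⁻¹).val)ᵀ := by
    have h5 := toGL_resSL (tD (1, -1)) T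
    rw [tD_val, theta_neg] at h5
    have h6 := congrArg Units.val h5
    refine h6.trans ?_
    ext k l
    rw [fieldAut_apply]
    change (gam (Matrix.SpecialLinearGroup.toGL T)).val k l = _
    rw [gam_val, ← map_inv]; rfl
  rw [h4, h2, transpose_sub, transpose_one, transpose_smul, transpose_vecMulVec, vecMulVec_neg,
    smul_neg, sub_eq_add_neg]

lemma RD.flip {α : MulAut (PS F ι)} {u v : ι → ι → ι → F} {f : ι → ι → F → F}
    (h : RD α u v f) : RD (tL (1, -1) * α) v (fun i j => - u i j) f where
  rt := by
    intro i j hij a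
    obtain ⟨T, h1, h2⟩ := h.rt i j hij a
    obtain ⟨T', h3, h4⟩ := tL_flip (h.orth i j hij) h1
    exact ⟨T', h3, by rw [MulAut.mul_apply, h2, h4]⟩
  orth := by
    intro i j hij
    rw [neg_dotProduct, dotProduct_comm, h.orth i j hij, neg_zero]
  one := h.one

lemma step4 {α : MulAut (PS F ι)} (x y : ι → ι → F) (h0 : ∀ i j, i ≠ j → y j ⬝ᵥ x i = 0)
    (h1 : ∀ i, y i ⬝ᵥ x i ≠ 0)
    (h : ∀ (i j : ι) (hij : i ≠ j) (a : F), ∃ (c : F) (T : Matrix.SpecialLinearGroup ι F),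
      T.val = 1 + c • vecMulVec (x i) (y j) ∧ α (pr (tv hij a)) = pr T) :
    ∃ (g : GL ι F) (f : ι → ι → F → F), ∀ (i j : ι) (hij : i ≠ j) (a : F),
      (cL g * α) (pr (tv hij a)) = pr (tv hij (f i j a)) := by
  let M : Matrix ι ι F := of fun k i => x i k
  let N : Matrix ι ι F := of fun j k => y j k
  have hNM : N * M = diagonal fun i => y i ⬝ᵥ x i := by
    ext j i
    change y j ⬝ᵥ x i = _
    by_cases hij : j = i
    · subst hij; simp
    · rw [diagonal_apply_ne _ hij, h0 i j (Ne.symm hij)]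
  have hdet : det M ≠ 0 := by
    intro h2
    have := congrArg det hNM
    rw [det_mul, h2, mul_zero, det_diagonal] at this
    exact Finset.prod_ne_zero_iff.2 (fun i _ => h1 i) this.symm
  let m : GL ι F := GeneralLinearGroup.mkOfDetNeZero M hdet
  have hm : m.val = M := rfl
  have key : ∀ i j c, (m⁻¹).val * (c • vecMulVec (x i) (y j)) * M =
      Matrix.single i j (c * (y j ⬝ᵥ x j)) := by
    intro i j c
    have e1 : (m⁻¹).val *ᵥ x i = Pi.single i 1 := by
      have : x i = M *ᵥ Pi.single i 1 := by ext k; simp [M]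
      rw [this, mulVec_mulVec, ← hm, Units.inv_mul, one_mulVec]
    have e2 : y j ᵥ* M = (y j ⬝ᵥ x j) • Pi.single j 1 := by
      ext k
      have := congrFun (congrFun hNM j) k
      change y j ⬝ᵥ x k = _ at this
      change y j ⬝ᵥ x k = _
      rw [this]
      by_cases hjk : j = k
      · subst hjk; simp
      · rw [diagonal_apply_ne _ hjk]; simp [Pi.single_apply, Ne.symm hjk]
    rw [mul_smul_comm, smul_mul_assoc, mul_vecMulVec, vecMulVec_mul, e1, e2]
    ext k l
    simp only [Matrix.smul_apply, vecMulVec_apply, Pi.smul_apply, smul_eq_mul, Pi.single_apply,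
      Matrix.single_apply]
    by_cases hk : i = k <;> by_cases hl : j = l <;> simp [hk, hl, eq_comm (a := k), eq_comm (a := l)]
  choose! c T hT hα using h
  refine ⟨m⁻¹, fun i j a => c i j a * (y j ⬝ᵥ x j), fun i j hij a => ?_⟩
  rw [MulAut.mul_apply, hα, cL_pr]
  congr 1
  apply Subtype.ext
  rw [resSL_cD_val, inv_inv, hT i j hij, hm, mul_add, add_mul, key, mul_one, ← hm, Units.inv_mul,
    tv_val]

lemma good_std {α : MulAut (PS F ι)} (h : ∃ (g : GL ι F) (σ : RingAut F),
    ∀ (i j : ι) (hij : i ≠ j) (a : F), (cL g * α) (pr (tv hij a)) = pr (tv hij (σ a))) :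
    Good α := by
  obtain ⟨g, σ, h⟩ := h
  apply Good.of_cL g
  apply Good.of_tL (σ⁻¹, 1)
  rw [fix_one (tL (σ⁻¹, 1) * (cL g * α))]
  · exact ⟨1, 1, by simp⟩
  · intro i j hij a
    rw [MulAut.mul_apply, h, tL_tv]
    congr 2
    exact σ.symm_apply_apply a

lemma straight [Finite F] {α : MulAut (PS F ι)} {u v : ι → ι → ι → F} {f : ι → ι → F → F}
    (h : RD α u v f) (hthird : ∀ i j : ι, ∃ k, k ≠ i ∧ k ≠ j) {i j k : ι} (hij : i ≠ j)
    (hjk : j ≠ k) (hik : i ≠ k) (hp : v i j ⬝ᵥ u j k ≠ 0) : Good α := by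
  have hall : ∀ x y z : ι, x ≠ y → y ≠ z → x ≠ z → v x y ⬝ᵥ u y z ≠ 0 :=
    fun x y z h1 h2 h3 => h.all hij hjk hik hp h1 h2 h3
  choose nx hnx _ using fun i : ι => hthird i i
  have hu : ∀ i j, i ≠ j → ∃ s : F, s ≠ 0 ∧ u i j = s • u i (nx i) := by
    intro i j hij
    by_cases h1 : nx i = j
    · exact ⟨1, one_ne_zero, by rw [h1, one_smul]⟩
    · obtain ⟨s, t, hs, ht, e1, e2⟩ := h.S (hnx i).symm h1 hij (hall _ _ _ (hnx i).symm h1 hij)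
      exact ⟨s, hs, e1⟩
  have hv : ∀ i j, i ≠ j → ∃ s : F, s ≠ 0 ∧ v i j = s • v (nx j) j := by
    intro i j hij
    by_cases h1 : i = nx j
    · exact ⟨1, one_ne_zero, by rw [h1, one_smul]⟩
    · obtain ⟨s, t, hs, ht, e1, e2⟩ := h.S h1 (hnx j) hij (hall _ _ _ h1 (hnx j) hij)
      exact ⟨t, ht, e2⟩
  apply (fun ⟨g, f, hh⟩ => Good.of_cL g (good_std (std_three i j hij hthird (f := f) hh)))
    (step4 (α := α) (fun i => u i (nx i)) (fun j => v (nx j) j) ?_ ?_ ?_)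
  · intro i j hij
    obtain ⟨s, hs, e1⟩ := hu i j hij
    obtain ⟨t, ht, e2⟩ := hv i j hij
    have := h.orth i j hij
    rw [e1, e2, smul_dotProduct, dotProduct_smul] at this
    simpa [hs, ht] using this
  · intro i
    obtain ⟨k, hk1, hk2⟩ := hthird i (nx i)
    obtain ⟨s, hs, e1⟩ := hu i k hk1.symm
    have := hall (nx i) i k (hnx i) hk1.symm hk2.symm
    rw [e1, dotProduct_smul] at this
    intro h0
    exact this (by rw [h0, smul_zero])
  · intro i j hij a
    obtain ⟨s, hs, e1⟩ := hu i j hij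
    obtain ⟨t, ht, e2⟩ := hv i j hij
    obtain ⟨T, t1, t2⟩ := h.rt i j hij a
    refine ⟨f i j a * s * t, T, ?_, t2⟩
    rw [t1, e1, e2, smul_vecMulVec, vecMulVec_smul]
    module

lemma good_three [Finite F] {α : MulAut (PS F ι)} {u v : ι → ι → ι → F} {f : ι → ι → F → F}
    (h : RD α u v f) (hthird : ∀ i j : ι, ∃ k, k ≠ i ∧ k ≠ j) {i j : ι} (hij : i ≠ j) :
    Good α := by
  obtain ⟨k, hk1, hk2⟩ := hthird i j
  rcases h.dich hij hk2.symm hk1.symm with h1 | h1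
  · exact straight h hthird hij hk2.symm hk1.symm h1.1
  · apply Good.of_tL (1, -1)
    refine straight h.flip hthird hij hk2.symm hk1.symm ?_
    rw [neg_dotProduct, dotProduct_comm]
    exact neg_ne_zero.2 h1.2

lemma RD.noncomm {α : MulAut (PS F ι)} {u v : ι → ι → ι → F} {f : ι → ι → F → F}
    (h : RD α u v f) {i j k l : ι} (hij : i ≠ j) (hkl : k ≠ l)
    (h1 : v i j ⬝ᵥ u k l = 0) (h2 : v k l ⬝ᵥ u i j = 0) :
    pr (tv hij (1 : F)) * pr (tv hkl 1) = pr (tv hkl 1) * pr (tv hij 1) := by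
  obtain ⟨S, s1, s2, s3⟩ := h.ex i j hij
  obtain ⟨T, t1, t2, t3⟩ := h.ex k l hkl
  apply α.injective
  rw [map_mul, map_mul, s2, t2, ← map_mul, ← map_mul]
  congr 1
  apply Subtype.ext
  change S.val * T.val = T.val * S.val
  rw [s1, t1]
  simp only [mul_add, add_mul, vv_mul, mul_one, one_mul, h1, h2, zero_smul]
  abel

end st

section two
variable {F : Type*} [Field F]

lemma dim2 {v u w : Fin 2 → F} (hv : v ≠ 0) (hu : u ≠ 0) (h1 : v ⬝ᵥ u = 0) (h2 : v ⬝ᵥ w = 0) :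
    ∃ s : F, w = s • u := by
  rw [dotProduct, Fin.sum_univ_two] at h1 h2
  by_cases h : v 0 = 0
  · have hv1 : v 1 ≠ 0 := by
      intro h3; apply hv; ext i; fin_cases i <;> assumption
    have e1 : u 1 = 0 := by rw [h, zero_mul, zero_add] at h1; exact (mul_eq_zero.1 h1).resolve_left hv1
    have e2 : w 1 = 0 := by rw [h, zero_mul, zero_add] at h2; exact (mul_eq_zero.1 h2).resolve_left hv1
    have hu0 : u 0 ≠ 0 := by
      intro h3; apply hu; ext i; fin_cases i <;> assumption
    refine ⟨w 0 / u 0, ?_⟩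
    ext i; fin_cases i
    · simp [hu0]
    · simp [e1, e2]
  · have hu1 : u 1 ≠ 0 := by
      intro h3
      rw [h3, mul_zero, add_zero] at h1
      have := (mul_eq_zero.1 h1).resolve_left h
      apply hu; ext i; fin_cases i <;> assumption
    refine ⟨w 1 / u 1, ?_⟩
    ext i; fin_cases i
    · simp only [Fin.zero_eta, Fin.isValue, Pi.smul_apply, smul_eq_mul]
      field_simp
      apply mul_left_cancel₀ h
      linear_combination u 1 * h2 - w 1 * h1
    · simp [hu1]

lemma noncomm2 : pr (tv (show (0 : Fin 2) ≠ 1 by decide) (1 : F)) *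
    pr (tv (show (1 : Fin 2) ≠ 0 by decide) 1) ≠
    pr (tv (show (1 : Fin 2) ≠ 0 by decide) 1) * pr (tv (show (0 : Fin 2) ≠ 1 by decide) 1) := by
  intro h
  set A := tv (show (0 : Fin 2) ≠ 1 by decide) (1 : F) with hA
  set B := tv (show (1 : Fin 2) ≠ 0 by decide) (1 : F) with hB
  have e : pr (A * B * A⁻¹) = pr B := by
    rw [map_mul, map_mul, h, map_inv, mul_inv_cancel_right]
  have e2 := pr_unip (conj_sq _ _ (tv_sq _ _)) (tv_sq _ _) e
  rw [mul_inv_eq_iff_eq_mul] at e2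
  have e3 : A.val * B.val = B.val * A.val := congrArg Subtype.val e2
  have e4 := congrFun (congrFun e3 0) 0
  rw [hA, hB, tv_val, tv_val] at e4
  simp [Matrix.mul_apply, Matrix.single] at e4

lemma good_two [Finite F] {α : MulAut (PS F (Fin 2))} {u v : Fin 2 → Fin 2 → Fin 2 → F}
    {f : Fin 2 → Fin 2 → F → F} (h : RD α u v f) : Good α := by
  have h01 : (0 : Fin 2) ≠ 1 := by decide
  have h10 : (1 : Fin 2) ≠ 0 := by decide
  have n1 := h.ne 0 1 h01
  have n2 := h.ne 1 0 h10
  have o1 := h.orth 0 1 h01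
  have o2 := h.orth 1 0 h10
  have a1 : v 0 1 ⬝ᵥ u 1 0 ≠ 0 := by
    intro h1
    obtain ⟨s, hs⟩ := dim2 n1.2 n2.1 h1 o1
    refine noncomm2 (h.noncomm h01 h10 h1 ?_)
    rw [hs, dotProduct_smul, o2, smul_zero]
  have a2 : v 1 0 ⬝ᵥ u 0 1 ≠ 0 := by
    intro h1
    obtain ⟨s, hs⟩ := dim2 n2.2 n1.1 h1 o2
    refine noncomm2 (h.noncomm h01 h10 ?_ h1)
    rw [hs, dotProduct_smul, o1, smul_zero]
  apply (fun ⟨g, f, hh⟩ => Good.of_cL g (good_std (std_two (f := f) hh)))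
    (step4 (α := α) (fun i => if i = 0 then u 0 1 else u 1 0)
      (fun j => if j = 0 then v 1 0 else v 0 1) ?_ ?_ ?_)
  · intro i j hij
    fin_cases i <;> fin_cases j
    · exact absurd rfl hij
    · simpa using o1
    · simpa using o2
    · exact absurd rfl hij
  · intro i
    fin_cases i
    · simpa using a2
    · simpa using a1
  · intro i j hij a
    obtain ⟨T, t1, t2⟩ := h.rt i j hij a
    refine ⟨f i j a, T, ?_, t2⟩
    rw [t1]
    fin_cases i <;> fin_cases j
    · exact absurd rfl hij
    · simp
    · simp
    · exact absurd rfl hij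

end two
end AbSup


namespace AbSup
open Matrix

section s2
variable {F : Type*} [Field F] {ι : Type*} [Fintype ι] [DecidableEq ι]

lemma pm_conj (π : Equiv.Perm ι) {i j o l : ι} (hij : i ≠ j) (hol : o ≠ l) (hi : π i = o)
    (hj : π j = l) (a : F) : resSL (cD (pm π)) (tv hol a) = tv hij a := by
  apply Subtype.ext
  rw [resSL_cD_val, tv_val, tv_val, mul_add, add_mul, mul_one, Units.mul_inv]
  congr 1
  change π.permMatrix F * Matrix.single o l a * (π⁻¹).permMatrix F = _
  rw [Equiv.Perm.permMatrix, Equiv.Perm.permMatrix, PEquiv.toMatrix_toPEquiv_mul,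
    PEquiv.mul_toMatrix_toPEquiv]
  ext k m
  subst hi hj
  simp only [Matrix.submatrix_apply, Matrix.single_apply, id]
  have : (Equiv.symm π⁻¹) m = π m := rfl
  rw [this]
  simp

lemma exists_perm {i j o l : ι} (hij : i ≠ j) (hol : o ≠ l) :
    ∃ π : Equiv.Perm ι, π i = o ∧ π j = l := by
  refine ⟨Equiv.swap (Equiv.swap i o j) l * Equiv.swap i o, ?_, ?_⟩
  · rw [Equiv.Perm.mul_apply, Equiv.swap_apply_left, Equiv.swap_apply_of_ne_of_ne]
    · intro h
      have : Equiv.swap i o i = Equiv.swap i o j := by rw [Equiv.swap_apply_left]; exact h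
      exact hij ((Equiv.swap i o).injective this)
    · exact hol
  · rw [Equiv.Perm.mul_apply, Equiv.swap_apply_left]

lemma root_conj {i j o l : ι} (hij : i ≠ j) (hol : o ≠ l) :
    ∃ (w : Matrix.SpecialLinearGroup ι F) (c : F), ∀ a : F,
      pr (tv hij a) = pr w * pr (tv hol (c * a)) * (pr w)⁻¹ := by
  obtain ⟨π, hi, hj⟩ := exists_perm hij hol
  let s : Fˣ := GeneralLinearGroup.det (pm π : GL ι F)
  let u : ι → Fˣ := Pi.mulSingle o s⁻¹
  have hd : GeneralLinearGroup.det (pm π * dg u : GL ι F) = 1 := by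
    rw [map_mul, det_dg]
    simp [u, s]
  have hw := toGL_toSL (pm π * dg u : GL ι F) hd
  refine ⟨toSL _ hd, ((u o)⁻¹ : Fˣ) * u l, fun a => ?_⟩
  rw [← MulAut.conj_apply, ← cL_coe, hw, map_mul, MulAut.mul_apply, cL_pr, dg_conj, cL_pr,
    pm_conj π hij hol hi hj]
  congr 2
  have n1 := (u o).ne_zero
  have n2 := (u l).ne_zero
  rw [Units.val_inv_eq_inv_val, Units.val_inv_eq_inv_val]
  field_simp

lemma rd_of {α : MulAut (PS F ι)} {o l : ι} (hol : o ≠ l) (g : Matrix.SpecialLinearGroup ι F)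
    (h : ∀ a : F, ∃ b : F, α (pr (tv hol a)) = pr (g * tv hol b * g⁻¹)) :
    ∃ u v f, RD α u v f := by
  have key : ∀ i j : ι, ∃ (u v : ι → F) (f : F → F), f 1 = 1 ∧ (i ≠ j → v ⬝ᵥ u = 0) ∧
      ∀ (hij : i ≠ j) (a : F), ∃ T : Matrix.SpecialLinearGroup ι F,
        T.val = 1 + f a • vecMulVec u v ∧ α (pr (tv hij a)) = pr T := by
    intro i j
    by_cases hij : i = j
    · exact ⟨0, 0, fun _ => 1, rfl, fun h => absurd hij h, fun h => absurd hij h⟩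
    obtain ⟨w, c, hw⟩ := root_conj (F := F) hij hol
    choose b hb using h
    obtain ⟨w', hw'⟩ := QuotientGroup.mk'_surjective _ (α (pr w))
    have e1 : ∀ a, α (pr (tv hij a)) = pr ((w' * g) * tv hol (b (c * a)) * (w' * g)⁻¹) := by
      intro a
      rw [hw, map_mul, map_mul, map_inv, hb, ← hw']
      change pr w' * _ * (pr w')⁻¹ = _
      simp only [map_mul, map_inv]
      group
    set H := w' * g
    have hinv : (H⁻¹).val * H.val = 1 := congrArg Subtype.val (inv_mul_cancel H)
    have hinv' : H.val * (H⁻¹).val = 1 := congrArg Subtype.val (mul_inv_cancel H)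
    have e2 : ∀ x : F, (H * tv hol x * H⁻¹).val =
        1 + x • vecMulVec (H.val *ᵥ Pi.single o 1) (Pi.single l 1 ᵥ* (H⁻¹).val) := by
      intro x
      change H.val * (tv hol x).val * (H⁻¹).val = _
      rw [tv_val, mul_add, add_mul, mul_one, hinv', ← vecMulVec_mul, ← mul_vecMulVec,
        ← Matrix.single_eq_single_vecMulVec_single, ← smul_mul_assoc, ← mul_smul_comm,
        Matrix.smul_single]
      simp
    have hb1 : b (c * 1) ≠ 0 := by
      intro h0
      have h1 := e1 1
      rw [h0, tv_zero, mul_one, mul_inv_cancel, map_one, MulEquiv.map_eq_one_iff] at h1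
      have h3 : pr (tv hij (1 : F)) = pr (tv hij 0) := by rw [h1, tv_zero, map_one]
      exact one_ne_zero (tv_inj hij h3)
    refine ⟨b (c * 1) • (H.val *ᵥ Pi.single o 1), Pi.single l 1 ᵥ* (H⁻¹).val,
      fun a => b (c * a) / b (c * 1), div_self hb1, fun _ => ?_, fun _ a => ⟨_, ?_, e1 a⟩⟩
    · rw [dotProduct_smul, dotProduct_mulVec, vecMul_vecMul, hinv]
      simp [hol]
    · rw [e2, smul_vecMulVec, smul_smul, div_mul_cancel₀ _ hb1]
  choose u v f h1 h2 h3 using key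
  exact ⟨u, v, f, ⟨h3, h2, h1⟩⟩

end s2
end AbSup


namespace AbSup
open Matrix

section syl
variable {F : Type*} [Field F] {m : ℕ}

/-- unitriangular matrices -/
def UU (F : Type*) [Field F] [Finite F] (m : ℕ) :
    Subgroup (Matrix.SpecialLinearGroup (Fin (m + 1)) F) :=
  let S : Submonoid (Matrix.SpecialLinearGroup (Fin (m + 1)) F) :=
    { carrier := {A | ∀ i j, j ≤ i → A.val i j = (1 : Matrix (Fin (m + 1)) (Fin (m + 1)) F) i j}
      one_mem' := fun i j _ => rfl
      mul_mem' := by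
        intro A B hA hB i j hij
        change (A.val * B.val) i j = _
        rw [Matrix.mul_apply, Finset.sum_eq_single i]
        · rw [hA i i le_rfl, Matrix.one_apply_eq, one_mul, hB i j hij]
        · intro k _ hk
          rcases lt_or_gt_of_ne hk with h | h
          · rw [hA i k h.le, Matrix.one_apply_ne h.ne', zero_mul]
          · rw [hB k j (hij.trans h.le), Matrix.one_apply_ne (hij.trans_lt h).ne', mul_zero]
        · simp }
  { S with
    inv_mem' := by
      intro A hA
      have h1 : A⁻¹ ∈ Submonoid.powers A := by
        rw [mem_powers_iff_mem_zpowers]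
        exact inv_mem (Subgroup.mem_zpowers A)
      exact (Submonoid.powers_le.2 hA : Submonoid.powers A ≤ S) h1 }

variable [Finite F]

lemma mem_UU {A : Matrix.SpecialLinearGroup (Fin (m + 1)) F} : A ∈ UU F m ↔
    ∀ i j, j ≤ i → A.val i j = (1 : Matrix (Fin (m + 1)) (Fin (m + 1)) F) i j := Iff.rfl

/-- coordinates -/
noncomputable def UUequiv : UU F m ≃ (∀ j : Fin (m + 1), Fin j.val → F) where
  toFun A j k := A.1.val ⟨k.val, k.2.trans j.2⟩ j
  invFun c := ⟨⟨of fun i j => if h : i < j then c j ⟨i.val, h⟩ else if i = j then 1 else 0, by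
      rw [det_of_upperTriangular]
      · simp
      · intro i j hij
        have h1 : ¬ i < j := not_lt.2 (le_of_lt hij)
        have h2 : i ≠ j := ne_of_gt hij
        simp [h1, h2]⟩, by
      intro i j hij
      have h1 : ¬ i < j := not_lt.2 hij
      simp [h1, Matrix.one_apply]⟩
  left_inv A := by
    apply Subtype.ext
    apply Subtype.ext
    ext i j
    by_cases h : i < j
    · simp [h]
    · have := A.2 i j (not_lt.1 h)
      rw [Matrix.one_apply] at this
      simp only [of_apply, h, dite_false]
      exact this.symm
  right_inv c := by
    funext j k
    have h : (⟨k.val, k.2.trans j.2⟩ : Fin (m + 1)) < j := k.2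
    simp [h]

lemma card_UU : Nat.card (UU F m) = ∏ j : Fin (m + 1), Nat.card F ^ j.val := by
  rw [Nat.card_congr UUequiv, Nat.card_pi]
  refine Finset.prod_congr rfl fun j _ => ?_
  rw [Nat.card_fun]; simp

lemma pr_inj_UU {A B : Matrix.SpecialLinearGroup (Fin (m + 1)) F} (hA : A ∈ UU F m)
    (hB : B ∈ UU F m) (h : pr A = pr B) : A = B := by
  obtain ⟨z, -, hz⟩ := (pr_eq_iff A B).1 h
  have h1 := congrFun (congrFun hz 0) 0
  rw [hA 0 0 le_rfl, Matrix.smul_apply, hB 0 0 le_rfl, Matrix.one_apply_eq, smul_eq_mul,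
    mul_one] at h1
  rw [← h1, one_smul] at hz
  exact Subtype.ext hz

lemma tv_mem {i j : Fin (m + 1)} (hij : i < j) (a : F) : tv hij.ne a ∈ UU F m := by
  intro k l hkl
  rw [tv_val, Matrix.add_apply, Matrix.single_apply, if_neg, add_zero]
  rintro ⟨rfl, rfl⟩
  exact absurd hij (not_lt.2 hkl)

lemma center_UU {A : Matrix.SpecialLinearGroup (Fin (m + 1)) F} (hA : A ∈ UU F m)
    (h0 : (0 : Fin (m + 1)) ≠ Fin.last m)
    (hc : ∀ B ∈ UU F m, pr A * pr B = pr B * pr A) : ∃ b, A = tv h0 b := by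
  have hc' : ∀ B ∈ UU F m, A.val * B.val = B.val * A.val := by
    intro B hB
    have h1 := hc B hB
    rw [← map_mul, ← map_mul] at h1
    exact congrArg Subtype.val (pr_inj_UU (mul_mem hA hB) (mul_mem hB hA) h1)
  have hs : ∀ i j : Fin (m + 1), i < j → A.val * Matrix.single i j 1 = Matrix.single i j 1 * A.val := by
    intro i j hij
    have h1 := hc' _ (tv_mem hij (1 : F))
    rw [tv_val, mul_add, add_mul, mul_one, one_mul] at h1
    exact add_left_cancel h1
  refine ⟨A.val 0 (Fin.last m), Subtype.ext ?_⟩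
  rw [tv_val]
  ext k l
  rw [Matrix.add_apply, Matrix.single_apply]
  by_cases hk : k = 0
  · by_cases hl : l = Fin.last m
    · subst hk hl; simp [h0]
    · rw [if_neg (fun h => hl h.2.symm), add_zero]
      have hl' : l < Fin.last m := lt_of_le_of_ne (Fin.le_last l) hl
      have h1 := congrFun (congrFun (hs l (Fin.last m) hl') k) (Fin.last m)
      rw [Matrix.mul_single_apply_same, mul_one] at h1
      rw [h1, Matrix.one_apply]
      by_cases hkl : k = l
      · subst hkl; rw [Matrix.single_mul_apply_same, hA _ _ le_rfl]; simp
      · rw [Matrix.single_mul_apply_of_ne _ _ _ _ _ hkl, if_neg hkl]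
  · rw [if_neg (fun h => hk h.1.symm), add_zero]
    have hk' : 0 < k := Fin.pos_iff_ne_zero.2 hk
    have h1 := congrFun (congrFun (hs 0 k hk') 0) l
    rw [Matrix.single_mul_apply_same, one_mul] at h1
    rw [← h1, Matrix.one_apply]
    by_cases hkl : k = l
    · subst hkl; rw [Matrix.mul_single_apply_same, hA _ _ le_rfl]; simp
    · rw [Matrix.mul_single_apply_of_ne _ _ _ _ _ (Ne.symm hkl), if_neg hkl]

lemma tv_center (h0 : (0 : Fin (m + 1)) ≠ Fin.last m) (a : F)
    {A : Matrix.SpecialLinearGroup (Fin (m + 1)) F} (hA : A ∈ UU F m) :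
    tv h0 a * A = A * tv h0 a := by
  apply Subtype.ext
  change (tv h0 a).val * A.val = A.val * (tv h0 a).val
  rw [tv_val, mul_add, add_mul, mul_one, one_mul]
  congr 1
  ext k l
  have e1 : (Matrix.single 0 (Fin.last m) a * A.val) k l = Matrix.single 0 (Fin.last m) a k l := by
    by_cases hk : k = 0
    · subst hk
      rw [Matrix.single_mul_apply_same, hA _ _ (Fin.le_last l), Matrix.one_apply,
        Matrix.single_apply]
      simp
    · rw [Matrix.single_mul_apply_of_ne _ _ _ _ _ hk, Matrix.single_apply,
        if_neg (fun h => hk h.1.symm)]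
  have e2 : (A.val * (Matrix.single 0 (Fin.last m) a : Matrix (Fin (m + 1)) (Fin (m + 1)) F)) k l = Matrix.single 0 (Fin.last m) a k l := by
    by_cases hl : l = Fin.last m
    · subst hl
      rw [Matrix.mul_single_apply_same, hA _ _ (Fin.zero_le k), Matrix.one_apply,
        Matrix.single_apply]
      simp [eq_comm]
    · rw [Matrix.mul_single_apply_of_ne _ _ _ _ _ hl, Matrix.single_apply,
        if_neg (fun h => hl h.2.symm)]
  rw [e1, e2]

lemma sylow_ex (F : Type*) [Field F] [Finite F] (m : ℕ) : ∃ (p : ℕ) (_ : Fact p.Prime)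
    (Q : Sylow p (PS F (Fin (m + 1)))), (Q : Subgroup (PS F (Fin (m + 1)))) = (UU F m).map pr := by
  haveI : Fintype F := Fintype.ofFinite F
  obtain ⟨p, hp⟩ := CharP.exists F
  obtain ⟨k, hpp, hk⟩ := FiniteField.card F p
  haveI : Fact p.Prime := ⟨hpp⟩
  have hq : Nat.card F = p ^ (k : ℕ) := by rw [Nat.card_eq_fintype_card, hk]
  have hU : IsPGroup p (UU F m) := by
    refine IsPGroup.of_card (n := ∑ j : Fin (m + 1), (k : ℕ) * j.val) ?_
    rw [card_UU, ← Finset.prod_pow_eq_pow_sum]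
    refine Finset.prod_congr rfl fun j _ => ?_
    rw [hq, pow_mul]
  have hP : IsPGroup p ((UU F m).map (pr : _ →* PS F (Fin (m + 1)))) := hU.map _
  have hcard : Nat.card ((UU F m).map (pr : _ →* PS F (Fin (m + 1)))) = Nat.card (UU F m) := by
    symm
    refine Nat.card_congr (Equiv.ofBijective (fun A => ⟨pr A.1, A.1, A.2, rfl⟩) ⟨?_, ?_⟩)
    · intro A B h
      exact Subtype.ext (pr_inj_UU A.2 B.2 (congrArg Subtype.val h))
    · rintro ⟨_, A, hA, rfl⟩
      exact ⟨⟨A, hA⟩, rfl⟩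
  have hidx : ¬ p ∣ ((UU F m).map (pr : _ →* PS F (Fin (m + 1)))).index := by
    intro hdvd
    have h1 : Nat.card (PS F (Fin (m + 1))) ∣ Nat.card (GL (Fin (m + 1)) F) :=
      (Subgroup.card_quotient_dvd_card _).trans
        (Subgroup.card_dvd_of_injective (Matrix.SpecialLinearGroup.toGL)
          Matrix.SpecialLinearGroup.toGL_injective)
    rw [Matrix.card_GL_field, ← Subgroup.card_mul_index ((UU F m).map pr), hcard, card_UU,
      ← Nat.card_eq_fintype_card] at h1
    have h2 : ∏ i : Fin (m + 1), (Nat.card F ^ (m + 1) - Nat.card F ^ (i : ℕ)) =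
        (∏ i : Fin (m + 1), Nat.card F ^ (i : ℕ)) *
          ∏ i : Fin (m + 1), (Nat.card F ^ (m + 1 - (i : ℕ)) - 1) := by
      rw [← Finset.prod_mul_distrib]
      refine Finset.prod_congr rfl fun i _ => ?_
      rw [Nat.mul_sub, mul_one, ← pow_add]
      congr 2
      omega
    have hq0 : 0 < Nat.card F := Nat.card_pos
    rw [h2] at h1
    have h3 := hdvd.trans (Nat.dvd_of_mul_dvd_mul_left (Finset.prod_pos fun i _ => pow_pos hq0 _) h1)
    rw [Prime.dvd_finsetProd_iff hpp.prime] at h3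
    obtain ⟨i, -, h4⟩ := h3
    have h5 : p ∣ Nat.card F ^ (m + 1 - (i : ℕ)) := by
      rw [hq]
      exact dvd_pow (dvd_pow_self p k.ne_zero) (by omega)
    have h6 : p ∣ 1 := by
      have := Nat.dvd_sub h5 h4
      rwa [Nat.sub_sub_self (Nat.one_le_pow _ _ hq0)] at this
    exact hpp.one_lt.ne' (Nat.dvd_one.1 h6)
  exact ⟨p, ‹_›, hP.toSylow hidx, rfl⟩

open scoped Pointwise in
lemma exists_rd (h0 : (0 : Fin (m + 1)) ≠ Fin.last m) (α : MulAut (PS F (Fin (m + 1)))) :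
    ∃ u v f, RD α u v f := by
  obtain ⟨p, _, Q, hQ⟩ := sylow_ex F m
  haveI : Finite (PS F (Fin (m + 1))) := inferInstance
  obtain ⟨x, hx⟩ := MulAction.exists_smul_eq (PS F (Fin (m + 1))) Q (α • Q)
  have hx' : MulAut.conj x • (Q : Subgroup (PS F (Fin (m + 1)))) =
    α • (Q : Subgroup (PS F (Fin (m + 1)))) := congrArg Sylow.toSubgroup hx
  rw [hQ] at hx'
  obtain ⟨g, hg⟩ := QuotientGroup.mk'_surjective _ x
  have key1 : ∀ A ∈ UU F m, ∃ B ∈ UU F m, α (pr A) = x * pr B * x⁻¹ := by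
    intro A hA
    have h1 : α • pr A ∈ α • (UU F m).map pr :=
      Subgroup.smul_mem_pointwise_smul _ _ _ (Subgroup.mem_map_of_mem _ hA)
    rw [← hx', Subgroup.mem_smul_pointwise_iff_exists] at h1
    obtain ⟨_, ⟨B, hB, rfl⟩, h2⟩ := h1
    exact ⟨B, hB, h2.symm⟩
  have key2 : ∀ B ∈ UU F m, ∃ A ∈ UU F m, α (pr A) = x * pr B * x⁻¹ := by
    intro B hB
    have h1 : MulAut.conj x • pr B ∈ MulAut.conj x • (UU F m).map pr :=
      Subgroup.smul_mem_pointwise_smul _ _ _ (Subgroup.mem_map_of_mem _ hB)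
    rw [hx', Subgroup.mem_smul_pointwise_iff_exists] at h1
    obtain ⟨_, ⟨A, hA, rfl⟩, h2⟩ := h1
    exact ⟨A, hA, h2⟩
  refine rd_of h0 g fun a => ?_
  have h0' : (0 : Fin (m + 1)) < Fin.last m := Fin.pos_iff_ne_zero.2 h0.symm
  obtain ⟨B, hB, e⟩ := key1 _ (tv_mem h0' a)
  obtain ⟨b, rfl⟩ := center_UU hB h0 (by
    intro C hC
    obtain ⟨D, hD, e'⟩ := key2 C hC
    have e1 : pr B = x⁻¹ * α (pr (tv h0 a)) * x := by rw [e]; group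
    have e2 : pr C = x⁻¹ * α (pr D) * x := by rw [e']; group
    have e3 : α (pr (tv h0 a)) * α (pr D) = α (pr D) * α (pr (tv h0 a)) := by
      rw [← map_mul, ← map_mul, ← map_mul, ← map_mul, tv_center h0 a hD]
    rw [e1, e2]
    calc _ = x⁻¹ * (α (pr (tv h0 a)) * α (pr D)) * x := by group
      _ = _ := by rw [e3]; group)
  refine ⟨b, e.trans ?_⟩
  rw [← hg, map_mul, map_mul, map_inv]

lemma aut_thm {n : ℕ} (hn : 2 ≤ n) (α : MulAut (PS F (Fin n))) :
    ∃ (g : GL (Fin n) F) (τ : TT F), α = cL g * tL τ := by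
  obtain ⟨m, rfl⟩ : ∃ m, n = m + 1 := ⟨n - 1, by omega⟩
  have h0 : (0 : Fin (m + 1)) ≠ Fin.last m := by
    intro h
    have := congrArg Fin.val h
    simp at this
    omega
  obtain ⟨u, v, f, h⟩ := exists_rd h0 α
  by_cases hm : m = 1
  · subst hm
    exact good_two h
  · refine good_three h (fun i j => ?_) h0
    have hc : ({i, j} : Finset (Fin (m + 1))).card < Fintype.card (Fin (m + 1)) := by
      refine (Finset.card_le_two).trans_lt ?_
      rw [Fintype.card_fin]; omega
    obtain ⟨k, hk⟩ := Finset.exists_mem_notMem_of_card_lt_card (s := {i, j})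
      (t := Finset.univ) (by rwa [Finset.card_univ])
    simp at hk
    exact ⟨k, hk.1, hk.2⟩

end syl
end AbSup

/-- A finite almost simple group whose socle is isomorphic to `PSL(n,q)`, `n ≥ 2`,
`(n,q) ≠ (2,2),(2,3)`, with abelian quotient over the socle, has an abelian supplement
to its socle. -/
theorem abelian_supplements_stmt_12
    (n q : ℕ) (hn : 2 ≤ n) (h22 : ¬(n = 2 ∧ q = 2)) (h23 : ¬(n = 2 ∧ q = 3))
    (F : Type*) [Field F] [Fintype F] (hcard : Fintype.card F = q)
    (G : Type*) [Group G] [Finite G] (G₀ : Subgroup G) [G₀.Normal]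
    (hsimple : IsSimpleGroup G₀) (hnonab : ∃ x y : G₀, x * y ≠ y * x)
    (hcent : Subgroup.centralizer (G₀ : Set G) = ⊥)
    (hiso : Nonempty (G₀ ≃* (Matrix.SpecialLinearGroup (Fin n) F ⧸
      Subgroup.center (Matrix.SpecialLinearGroup (Fin n) F))))
    (hab : ∀ x y : G ⧸ G₀, x * y = y * x) :
    ∃ A : Subgroup G, (∀ x y : A, (x : G) * y = (y : G) * x) ∧ A ⊔ G₀ = ⊤ := by
  obtain ⟨e⟩ := hiso
  exact AbSup.glue (by omega) (AbSup.aut_thm hn) G G₀ hcent e hab
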